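/- Let (Ω, C, Λ) be a naive convex co-compact triple. Suppose there exist distinct points x, y₁, y₂, y₃ in the ideal boundary ∂_i C such that the closed segments [x,y₁], [x,y₂], [x,y₃] (taken in closure(Ω)) all lie in ∂Ω, while the open segments (y₁,y₂), (y₂,y₃), (y₃,y₁) all lie in Ω. Then there exists w ∈ ∂_i C with cdim_{F_Ω(w)}(∂_i C ∩ F_Ω(w)) ≥ 2. -/

import Mathlib

open Set Filter

noncomputable section

/-- Real projective space `P(ℝ^d)`, with the quotient topology. -/
abbrev PSpace (d : ℕ) := Projectivization ℝ (Fin d → ℝ)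

instance PSpace.instTopologicalSpace (d : ℕ) : TopologicalSpace (PSpace d) :=
  inferInstanceAs (TopologicalSpace (Quotient (projectivizationSetoid ℝ (Fin d → ℝ))))

namespace Paper

variable {d : ℕ}

/-- Inhomogeneous coordinates in the affine chart determined by the linear functional `f`:
a projective point `[v]` with `f v ≠ 0` is sent to the representative `v / f v` lying in the
affine hyperplane `{f = 1}`. -/
def chartMap (f : (Fin d → ℝ) →ₗ[ℝ] ℝ) (x : PSpace d) : Fin d → ℝ :=
  (f x.rep)⁻¹ • x.rep

/-- A subset of `P(ℝ^d)` is properly convex if there is an affine chart in which it is a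
bounded convex set. -/
def IsProperlyConvex (C : Set (PSpace d)) : Prop :=
  ∃ f : (Fin d → ℝ) →ₗ[ℝ] ℝ, (∀ x ∈ closure C, f x.rep ≠ 0) ∧
    Convex ℝ (chartMap f '' C) ∧ Bornology.IsBounded (chartMap f '' C)

/-- A properly convex domain: an open, nonempty, properly convex subset of `P(ℝ^d)`. -/
def IsPCDomain (Ω : Set (PSpace d)) : Prop :=
  IsOpen Ω ∧ Ω.Nonempty ∧ IsProperlyConvex Ω

open Classical in
/-- A choice of an affine chart containing the properly convex set `C`. -/
def chartOf (C : Set (PSpace d)) : (Fin d → ℝ) →ₗ[ℝ] ℝ :=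
  if h : IsProperlyConvex C then h.choose else 0

/-- The chart map associated to the chosen chart of `C`. -/
def cmap (C : Set (PSpace d)) : PSpace d → Fin d → ℝ := chartMap (chartOf C)

/-- The Hilbert distance between `u` and `v` computed in an affine chart where the convex set
is `O`: writing the line through `u, v` as `t ↦ u + t(v-u)`, with boundary parameters
`tm = inf {t | u + t(v-u) ∈ O} ≤ 0` and `tp = sup {...} ≥ 1`, the cross-ratio
`[a,u,v,b]` of `a = u + tm(v-u), u, v, b = u + tp(v-u)` equals `(tp(1-tm))/((-tm)(tp-1))`. -/
def hilbertDistChart (O : Set (Fin d → ℝ)) (u v : Fin d → ℝ) : ℝ :=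
  if u = v then 0
  else
    (1 / 2) * Real.log
      ((sSup {t : ℝ | u + t • (v - u) ∈ O} * (1 - sInf {t : ℝ | u + t • (v - u) ∈ O})) /
        ((-(sInf {t : ℝ | u + t • (v - u) ∈ O})) * (sSup {t : ℝ | u + t • (v - u) ∈ O} - 1)))

/-- The Hilbert metric of a properly convex set `C` (open in its span). -/
def hilbertDist (C : Set (PSpace d)) (x y : PSpace d) : ℝ :=
  hilbertDistChart (cmap C '' C) (cmap C x) (cmap C y)

/-- The closed projective line segment `[x,y]` contained in `closure C`. -/
def projSeg (C : Set (PSpace d)) (x y : PSpace d) : Set (PSpace d) :=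
  {z ∈ closure C | cmap C z ∈ segment ℝ (cmap C x) (cmap C y)}

/-- The open projective line segment `(x,y)` contained in `closure C`. -/
def projOpenSeg (C : Set (PSpace d)) (x y : PSpace d) : Set (PSpace d) :=
  {z ∈ closure C | cmap C z ∈ openSegment ℝ (cmap C x) (cmap C y)}

/-- The open face `F_C(x)` of a point `x ∈ closure C`: the set `{x}` together with all
`y ∈ closure C` such that some open line segment contained in `closure C` contains
both `x` and `y`. -/
def face (C : Set (PSpace d)) (x : PSpace d) : Set (PSpace d) :=
  insert x {y ∈ closure C | ∃ a ∈ closure C, ∃ b ∈ closure C,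
    x ∈ projOpenSeg C a b ∧ y ∈ projOpenSeg C a b}

/-- The ideal boundary `∂_i C = closure C \ C`. -/
def idealBdry (C : Set (PSpace d)) : Set (PSpace d) := closure C \ C

/-- The dimension of a subset `B`, computed in the chart of the ambient convex set `C`. -/
def pdimIn (C B : Set (PSpace d)) : ℕ :=
  Module.finrank ℝ (affineSpan ℝ (cmap C '' B)).direction

/-- The dimension of a convex subset of `P(ℝ^d)`. -/
def pdim (A : Set (PSpace d)) : ℕ := pdimIn A A

/-- The coarse dimension `cdim_C(A)` of a nonempty subset `A` of a properly convex set `C`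
open in its span: the smallest `k` such that `A` is contained in an `R`-neighborhood (for the
Hilbert metric of `C`) of a `k`-dimensional convex subset `B ⊆ C`. -/
def cdim (C A : Set (PSpace d)) : ℕ :=
  sInf {k : ℕ | ∃ R : ℝ, 0 < R ∧ ∃ B : Set (PSpace d), B ⊆ C ∧
    Convex ℝ (cmap C '' B) ∧ pdimIn C B = k ∧
    A ⊆ {p ∈ C | ∃ q ∈ B, hilbertDist C p q < R}}

/-- The cone over the standard open `(p-1)`-dimensional simplex: vectors whose first `p`
coordinates are positive and whose remaining coordinates vanish. -/
def simplexCone (p : ℕ) : Set (Fin d → ℝ) :=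
  {v | (∀ i : Fin d, (i : ℕ) < p → 0 < v i) ∧ ∀ i : Fin d, p ≤ (i : ℕ) → v i = 0}

/-- `S` is the image under `g ∈ PGL_d(ℝ)` of the standard open simplex with `p` vertices. -/
def IsSimplexWithMap (p : ℕ) (S : Set (PSpace d)) (g : (Fin d → ℝ) ≃ₗ[ℝ] (Fin d → ℝ)) : Prop :=
  S = {q : PSpace d | ∃ v ∈ simplexCone (d := d) p, ∃ hv : v ≠ 0,
        q = Projectivization.mk ℝ (g v) (by simpa using hv)}

/-- `S ⊆ P(ℝ^d)` is a simplex of dimension `k`. -/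
def IsSimplexOfDim (k : ℕ) (S : Set (PSpace d)) : Prop :=
  k + 1 ≤ d ∧ ∃ g : (Fin d → ℝ) ≃ₗ[ℝ] (Fin d → ℝ), IsSimplexWithMap (k + 1) S g

/-- `S` is a simplex with vertices `v 0, …, v (p-1)` (so of dimension `p - 1`). -/
def HasVertices {p : ℕ} (S : Set (PSpace d)) (v : Fin p → PSpace d) : Prop :=
  ∃ (hp : p ≤ d) (g : (Fin d → ℝ) ≃ₗ[ℝ] (Fin d → ℝ)),
    IsSimplexWithMap p S g ∧
    ∀ j : Fin p, v j = Projectivization.mk ℝ (g (Pi.single (Fin.castLE hp j) 1))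
      (by
        simp only [ne_eq, EmbeddingLike.map_eq_zero_iff]
        intro h
        have h1 := congrFun h (Fin.castLE hp j)
        rw [Pi.single_eq_same] at h1
        exact one_ne_zero (α := ℝ) h1)

/-- `A ⊆ B` is properly embedded if the inclusion map `A ↪ B` is proper. -/
def IsProperlyEmbedded (A B : Set (PSpace d)) : Prop :=
  ∃ h : A ⊆ B, IsProperMap (Set.inclusion h)

/-- The projective action of `GL(ℝ^d)` (hence of `PGL_d(ℝ)`) on `P(ℝ^d)`. -/
def pact (g : (Fin d → ℝ) ≃ₗ[ℝ] (Fin d → ℝ)) : PSpace d → PSpace d :=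
  Projectivization.map g.toLinearMap g.injective

/-- A naive convex co-compact triple `(Ω, C, Λ)`. -/
structure NCCTriple (d : ℕ) where
  Ω : Set (PSpace d)
  C : Set (PSpace d)
  Λ : Subgroup ((Fin d → ℝ) ≃ₗ[ℝ] (Fin d → ℝ))
  isOpen_Ω : IsOpen Ω
  nonempty_Ω : Ω.Nonempty
  properlyConvex_Ω : IsProperlyConvex Ω
  inv_Ω : ∀ g ∈ Λ, pact g '' Ω = Ω
  infinite_Λ : (Λ : Set ((Fin d → ℝ) ≃ₗ[ℝ] (Fin d → ℝ))).Infinite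
  discrete_Λ : ∀ K ⊆ Ω, IsCompact K →
    {g : (Fin d → ℝ) ≃ₗ[ℝ] (Fin d → ℝ) | g ∈ Λ ∧ (pact g '' K ∩ K).Nonempty}.Finite
  C_nonempty : C.Nonempty
  C_sub : C ⊆ Ω
  C_closedInΩ : closure C ∩ Ω ⊆ C
  C_convex : Convex ℝ (cmap Ω '' C)
  inv_C : ∀ g ∈ Λ, pact g '' C = C
  cocompact : ∃ K : Set (PSpace d), K ⊆ C ∧ IsCompact K ∧ C ⊆ ⋃ g ∈ Λ, pact g '' K

/-- The orbit of a point under a subgroup of `PGL_d(ℝ)`. -/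
def porbit (Λ : Subgroup ((Fin d → ℝ) ≃ₗ[ℝ] (Fin d → ℝ))) (p : PSpace d) : Set (PSpace d) :=
  {q | ∃ g ∈ Λ, q = pact g p}

/-- The full orbital limit set `L_Ω(Λ)`. -/
def limitSet (Ω : Set (PSpace d)) (Λ : Subgroup ((Fin d → ℝ) ≃ₗ[ℝ] (Fin d → ℝ))) :
    Set (PSpace d) :=
  ⋃ p ∈ Ω, (closure (porbit Λ p) \ porbit Λ p)

/-- The convex hull of `X ⊆ closure Ω` taken inside `Ω`. -/
def convHullIn (Ω X : Set (PSpace d)) : Set (PSpace d) :=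
  {z ∈ Ω | cmap Ω z ∈ convexHull ℝ (cmap Ω '' X)}

/-- `C_Ω(Λ)`: the convex hull of the full orbital limit set in `Ω`. -/
def coreC (Ω : Set (PSpace d)) (Λ : Subgroup ((Fin d → ℝ) ≃ₗ[ℝ] (Fin d → ℝ))) :
    Set (PSpace d) :=
  convHullIn Ω (limitSet Ω Λ)

/-- A convex co-compact group `Λ ⊆ Aut(Ω)`: an infinite discrete subgroup preserving `Ω`
such that `C_Ω(Λ)` is nonempty and `Λ` acts cocompactly on it. -/
structure CCSetup (d : ℕ) where
  Ω : Set (PSpace d)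
  Λ : Subgroup ((Fin d → ℝ) ≃ₗ[ℝ] (Fin d → ℝ))
  isOpen_Ω : IsOpen Ω
  nonempty_Ω : Ω.Nonempty
  properlyConvex_Ω : IsProperlyConvex Ω
  inv_Ω : ∀ g ∈ Λ, pact g '' Ω = Ω
  infinite_Λ : (Λ : Set ((Fin d → ℝ) ≃ₗ[ℝ] (Fin d → ℝ))).Infinite
  discrete_Λ : ∀ K ⊆ Ω, IsCompact K →
    {g : (Fin d → ℝ) ≃ₗ[ℝ] (Fin d → ℝ) | g ∈ Λ ∧ (pact g '' K ∩ K).Nonempty}.Finite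
  core_nonempty : (coreC Ω Λ).Nonempty
  cocompact : ∃ K : Set (PSpace d), K ⊆ coreC Ω Λ ∧ IsCompact K ∧
    coreC Ω Λ ⊆ ⋃ g ∈ Λ, pact g '' K

/-- The Gromov product of `x, y` at `w`, with respect to the Hilbert metric of `Ω`. -/
def gromovProd (Ω : Set (PSpace d)) (w x y : PSpace d) : ℝ :=
  (hilbertDist Ω x w + hilbertDist Ω y w - hilbertDist Ω x y) / 2

/-- `(C, d_Ω)` is Gromov hyperbolic. -/
def GromovHyperbolicOn (Ω C : Set (PSpace d)) : Prop :=
  ∃ δ : ℝ, 0 ≤ δ ∧ ∀ x ∈ C, ∀ y ∈ C, ∀ z ∈ C, ∀ w ∈ C,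
    min (gromovProd Ω w x y) (gromovProd Ω w y z) - δ ≤ gromovProd Ω w x z

/-- The open Hilbert-metric ball in `Ω`. -/
def hBall (Ω : Set (PSpace d)) (x : PSpace d) (r : ℝ) : Set (PSpace d) :=
  {y ∈ Ω | hilbertDist Ω x y < r}

/-- The Hausdorff distance between `A` and `B` (w.r.t. the Hilbert metric of `Ω`)
is less than `ε`. -/
def hausLT (Ω A B : Set (PSpace d)) (ε : ℝ) : Prop :=
  (∀ a ∈ A, ∃ b ∈ B, hilbertDist Ω a b < ε) ∧ ∀ b ∈ B, ∃ a ∈ A, hilbertDist Ω a b < ε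

/-- The Hausdorff distance between `A` and `B` (w.r.t. the Hilbert metric of `Ω`)
is at most `r`. -/
def hausdorffDistLE (Ω A B : Set (PSpace d)) (r : ℝ) : Prop :=
  ∀ ε : ℝ, 0 < ε → hausLT Ω A B (r + ε)

/-- Convergence `F n → C` in the local Hausdorff topology induced by `d_Ω`. -/
def LocalHausConv (Ω : Set (PSpace d)) (F : ℕ → Set (PSpace d)) (C : Set (PSpace d)) : Prop :=
  ∀ x ∈ Ω, ∀ r : ℝ, 0 < r → ∀ ε : ℝ, 0 < ε →
    ∀ᶠ n in atTop, hausLT Ω (F n ∩ hBall Ω x r) (C ∩ hBall Ω x r) ε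

/-- A collection `𝒮` of closed subsets of `Ω` is closed and discrete in the local Hausdorff
topology: any sequence in `𝒮` converging to a nonempty closed subset of `Ω` has limit in `𝒮`
and is eventually equal to its limit. -/
def ClosedAndDiscreteInLHT (Ω : Set (PSpace d)) (𝒮 : Set (Set (PSpace d))) : Prop :=
  ∀ F : ℕ → Set (PSpace d), (∀ n, F n ∈ 𝒮) →
    ∀ C : Set (PSpace d), C.Nonempty → C ⊆ Ω → closure C ∩ Ω ⊆ C → LocalHausConv Ω F C →
      C ∈ 𝒮 ∧ ∀ᶠ n in atTop, F n = C


set_option linter.unusedSectionVars false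
set_option linter.unusedVariables false

section Core
variable {V : Type*} [NormedAddCommGroup V] [NormedSpace ℝ V] [FiniteDimensional ℝ V]

theorem cone_closure_add {U : Set V} (hadd : ∀ a ∈ U, ∀ b ∈ U, a + b ∈ U)
    {a b : V} (ha : a ∈ closure U) (hb : b ∈ closure U) : a + b ∈ closure U :=
  map_mem_closure₂ continuous_add ha hb hadd

theorem cone_closure_smul {U : Set V} (hne : U.Nonempty)
    (hsm : ∀ a ∈ U, ∀ c : ℝ, 0 < c → c • a ∈ U)
    {a : V} (ha : a ∈ closure U) {c : ℝ} (hc : 0 ≤ c) : c • a ∈ closure U := by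
  rcases hc.eq_or_lt with rfl | hc
  · obtain ⟨u, hu⟩ := hne
    rw [zero_smul]
    have ht : Tendsto (fun t : ℝ => t • u) (nhdsWithin 0 (Set.Ioi 0)) (nhds ((0 : ℝ) • u)) :=
      ((continuous_id.smul continuous_const).tendsto 0).mono_left nhdsWithin_le_nhds
    rw [zero_smul] at ht
    refine mem_closure_of_tendsto ht ?_
    filter_upwards [self_mem_nhdsWithin] with t htt
    exact hsm u hu t htt
  · exact map_mem_closure (continuous_const_smul c) ha (fun a ha => hsm a ha c hc)

/-- interior plus closure is interior -/
theorem cone_open_add {U : Set V} (hU : IsOpen U) (hadd : ∀ a ∈ U, ∀ b ∈ U, a + b ∈ U)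
    {a b : V} (ha : a ∈ U) (hb : b ∈ closure U) : a + b ∈ U := by
  have hO : IsOpen ((fun v => a + b - v) ⁻¹' U) := hU.preimage (by fun_prop)
  obtain ⟨v, hv1, hv2⟩ := mem_closure_iff.1 hb _ hO (by simpa using ha)
  have := hadd _ hv1 _ hv2
  simpa using this

theorem cone_absorb {U : Set V} (hU : IsOpen U)
    (hsm : ∀ a ∈ U, ∀ c : ℝ, 0 < c → c • a ∈ U)
    {a : V} (ha : a ∈ U) (b : V) : ∃ ε : ℝ, 0 < ε ∧ a - ε • b ∈ U := by
  have hc : Tendsto (fun t : ℝ => a - t • b) (nhdsWithin 0 (Set.Ioi 0)) (nhds (a - (0 : ℝ) • b)) := by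
    have : Continuous (fun t : ℝ => a - t • b) := by fun_prop
    exact (this.tendsto 0).mono_left nhdsWithin_le_nhds
  rw [zero_smul, sub_zero] at hc
  obtain ⟨t, h1, h2⟩ := ((hc.eventually (hU.mem_nhds ha)).and self_mem_nhdsWithin).exists
  exact ⟨t, h2, h1⟩

theorem core {U D K : Set V} (f : V →ₗ[ℝ] ℝ) (M : ℝ)
    (hU : IsOpen U) (hadd : ∀ a ∈ U, ∀ b ∈ U, a + b ∈ U)
    (hsm : ∀ a ∈ U, ∀ c : ℝ, 0 < c → c • a ∈ U)
    (hM : ∀ v ∈ closure U, ‖v‖ ≤ M * f v) (hf0 : ∀ v ∈ closure U, 0 ≤ f v)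
    (hDU : D ⊆ U) (haddD : ∀ a ∈ D, ∀ b ∈ D, a + b ∈ D)
    (hsmD : ∀ a ∈ D, ∀ c : ℝ, 0 < c → c • a ∈ D)
    (hcl : closure D ∩ U ⊆ D)
    (hKc : IsCompact K) (hKD : K ⊆ D)
    (hco : ∀ p ∈ D, ∃ A : V ≃ₗ[ℝ] V, (∀ v ∈ U, A v ∈ U) ∧ (∀ v ∈ U, A.symm v ∈ U) ∧
      (∀ v ∈ D, A v ∈ D) ∧ A p ∈ K)
    (x : V) (y : Fin 3 → V) (hx : x ∈ closure D) (hy : ∀ i, y i ∈ closure D) (hx0 : x ≠ 0)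
    (hxy : ∀ i, ∀ s : ℝ, 0 ≤ s → x + s • y i ∉ U)
    (hyy : ∀ i j, i ≠ j → y i + y j ∈ U) :
    ∃ Y : Fin 3 → V, (∀ i, Y i ∈ closure D) ∧ (Y 0 + Y 1 + Y 2 ∉ U) ∧
      (∃ m : ℝ, 0 < m ∧ ∀ i j, i ≠ j → ∀ k, m • (Y i + Y j) - Y k ∈ closure U) ∧
      (∀ i, ∀ m : ℝ, 0 ≤ m → m • Y i - (Y 0 + Y 1 + Y 2) ∉ closure U) := by
  have hUne : U.Nonempty := ⟨_, hyy 0 1 (by decide)⟩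
  have hDcU : closure D ⊆ closure U := closure_mono hDU
  have hS : y 0 + y 1 + y 2 ∈ U := cone_open_add hU hadd (hyy 0 1 (by decide)) (hDcU (hy 2))
  have hSD : y 0 + y 1 + y 2 ∈ closure D :=
    cone_closure_add haddD (cone_closure_add haddD (hy 0) (hy 1)) (hy 2)
  have hDne : D.Nonempty := ⟨_, hcl ⟨hSD, hS⟩⟩
  let s : ℕ → ℝ := fun n => 1 / ((n : ℝ) + 1)
  have hs : ∀ n, 0 < s n := fun n => by positivity
  have hs0 : Tendsto s atTop (nhds 0) := tendsto_one_div_add_atTop_nhds_zero_nat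
  have hp : ∀ n, s n • (y 0 + y 1 + y 2) + x ∈ D := fun n =>
    hcl ⟨cone_closure_add haddD (cone_closure_smul hDne hsmD hSD (hs n).le) hx,
      cone_open_add hU hadd (hsm _ hS _ (hs n)) (hDcU hx)⟩
  choose A hA1 hA2 hA3 hA4 using fun n => hco _ (hp n)
  have hAc : ∀ n, ∀ v ∈ closure U, A n v ∈ closure U := fun n v hv =>
    map_mem_closure (A n).toLinearMap.continuous_of_finiteDimensional hv (hA1 n)
  have hAc2 : ∀ n, ∀ v ∈ closure U, (A n).symm v ∈ closure U := fun n v hv =>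
    map_mem_closure (A n).symm.toLinearMap.continuous_of_finiteDimensional hv (hA2 n)
  have hAD : ∀ n, ∀ v ∈ closure D, A n v ∈ closure D := fun n v hv =>
    map_mem_closure (A n).toLinearMap.continuous_of_finiteDimensional hv (hA3 n)
  have hfc : Continuous f := f.continuous_of_finiteDimensional
  -- bounded
  obtain ⟨b, hb⟩ : ∃ b, ∀ k ∈ K, f k ≤ b := by
    obtain ⟨b, hb⟩ := (hKc.image hfc).bddAbove
    exact ⟨b, fun k hk => hb ⟨k, hk, rfl⟩⟩
  let 𝒰 : Ultrafilter ℕ := Filter.hyperfilter ℕ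
  have h𝒰 : (𝒰 : Filter ℕ) ≤ atTop := by
    rw [← Nat.cofinite_eq_atTop]; exact Filter.hyperfilter_le_cofinite
  have hs𝒰 : Tendsto s 𝒰 (nhds 0) := hs0.mono_left h𝒰
  have hbd : ∀ Z : ℕ → V, (∀ n, Z n ∈ closure U) → (∀ n, f (Z n) ≤ b) →
      ∃ z, Tendsto Z 𝒰 (nhds z) := by
    intro Z hZ hZb
    have hc : IsCompact (Metric.closedBall (0 : V) (|M| * b)) := isCompact_closedBall _ _
    have hin : ∀ n, Z n ∈ Metric.closedBall (0 : V) (|M| * b) := fun n => by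
      rw [mem_closedBall_zero_iff]
      calc ‖Z n‖ ≤ M * f (Z n) := hM _ (hZ n)
        _ ≤ |M| * f (Z n) := mul_le_mul_of_nonneg_right (le_abs_self M) (hf0 _ (hZ n))
        _ ≤ |M| * b := mul_le_mul_of_nonneg_left (hZb n) (abs_nonneg M)
    obtain ⟨z, -, hz⟩ := hc.ultrafilter_le_nhds' (𝒰.map Z)
      (Ultrafilter.mem_map.2 (Filter.univ_mem' hin))
    exact ⟨z, hz⟩
  obtain ⟨P, hPK, hP⟩ : ∃ P ∈ K,
      Tendsto (fun n => A n (s n • (y 0 + y 1 + y 2) + x)) 𝒰 (nhds P) := by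
    obtain ⟨z, hz, hz2⟩ := hKc.ultrafilter_le_nhds'
      (𝒰.map (fun n => A n (s n • (y 0 + y 1 + y 2) + x))) (Ultrafilter.mem_map.2 (Filter.univ_mem' hA4))
    exact ⟨z, hz, hz2⟩
  have hYU : ∀ i n, A n (s n • y i) ∈ closure U := fun i n =>
    hAc n _ (cone_closure_smul hUne hsm (hDcU (hy i)) (hs n).le)
  have hXU : ∀ n, A n x ∈ closure U := fun n => hAc n _ (hDcU hx)
  have hsum : ∀ n, A n (s n • (y 0 + y 1 + y 2) + x) =
      A n (s n • y 0) + A n (s n • y 1) + A n (s n • y 2) + A n x := fun n => by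
    simp only [smul_add, map_add]
  have hfs : ∀ n, f (A n (s n • y 0)) + f (A n (s n • y 1)) + f (A n (s n • y 2)) + f (A n x) ≤ b := by
    intro n
    have := hb _ (hA4 n)
    rw [hsum] at this
    simpa only [map_add] using this
  obtain ⟨X, hX⟩ := hbd (fun n => A n x) hXU (fun n => by
    linarith [hfs n, hf0 _ (hYU 0 n), hf0 _ (hYU 1 n), hf0 _ (hYU 2 n)])
  have hYex : ∀ i, ∃ z, Tendsto (fun n => A n (s n • y i)) 𝒰 (nhds z) := by
    intro i
    refine hbd _ (hYU i) (fun n => ?_)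
    have h := hfs n
    have h0 := hf0 _ (hYU 0 n)
    have h1 := hf0 _ (hYU 1 n)
    have h2 := hf0 _ (hYU 2 n)
    have h3 := hf0 _ (hXU n)
    fin_cases i <;> simp only [Fin.zero_eta, Fin.mk_one, Fin.reduceFinMk] <;> linarith
  choose Y hY using hYex
  have hPe : P = Y 0 + Y 1 + Y 2 + X := by
    refine tendsto_nhds_unique hP ?_
    simp only [hsum]
    exact (((hY 0).add (hY 1)).add (hY 2)).add hX
  have hPU : Y 0 + Y 1 + Y 2 + X ∈ U := hPe ▸ hDU (hKD hPK)
  have hYD : ∀ i, Y i ∈ closure D := fun i =>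
    isClosed_closure.mem_of_tendsto (hY i) (Filter.Eventually.of_forall fun n =>
      hAD n _ (cone_closure_smul hDne hsmD (hy i) (hs n).le))
  refine ⟨Y, hYD, ?_, ?_, ?_⟩
  · intro hW
    obtain ⟨ε, hε, h⟩ := cone_absorb hU hsm hW X
    have ht : Tendsto (fun n => A n (s n • y 0) + A n (s n • y 1) + A n (s n • y 2) - ε • A n x) 𝒰
        (nhds (Y 0 + Y 1 + Y 2 - ε • X)) :=
      (((hY 0).add (hY 1)).add (hY 2)).sub (hX.const_smul ε)
    have hev := ht.eventually (hU.mem_nhds h)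
    have hev2 : ∀ᶠ n in (𝒰 : Filter ℕ), s n • (y 0 + y 1 + y 2) - ε • x ∈ closure U := by
      filter_upwards [hev] with n hn
      have := subset_closure (hA2 n _ hn)
      simpa only [map_add, map_sub, map_smul, LinearEquiv.symm_apply_apply, ← smul_add] using this
    have hlim : Tendsto (fun n => s n • (y 0 + y 1 + y 2) - ε • x) 𝒰
        (nhds ((0 : ℝ) • (y 0 + y 1 + y 2) - ε • x)) :=
      (hs𝒰.smul_const _).sub tendsto_const_nhds
    have hm := isClosed_closure.mem_of_tendsto hlim hev2
    rw [zero_smul, zero_sub] at hm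
    have h1 := hf0 _ hm
    have h2 := hf0 _ (hDcU hx)
    have h3 := hM _ (hDcU hx)
    simp only [map_neg, map_smul, smul_eq_mul] at h1
    have h4 : f x = 0 := by nlinarith
    rw [h4, mul_zero] at h3
    exact hx0 (norm_le_zero_iff.1 h3)
  · have hone : ∀ i j k, ∃ m0 : ℝ, i ≠ j → ∀ m, m0 ≤ m → m • (y i + y j) - y k ∈ closure U := by
      intro i j k
      by_cases hij : i = j
      · exact ⟨0, fun h => absurd hij h⟩
      obtain ⟨ε, hε, h⟩ := cone_absorb hU hsm (hyy i j hij) (y k)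
      refine ⟨ε⁻¹, fun _ m hm => ?_⟩
      have h1 : m • (y i + y j) - y k =
          ε⁻¹ • (y i + y j - ε • y k) + (m - ε⁻¹) • (y i + y j) := by
        rw [smul_sub, smul_smul, inv_mul_cancel₀ hε.ne', one_smul, sub_smul]; abel
      rw [h1]
      exact cone_closure_add hadd
        (cone_closure_smul hUne hsm (subset_closure h) (by positivity))
        (cone_closure_smul hUne hsm (subset_closure (hyy i j hij)) (by linarith))
    choose m0 hm0 using hone
    let m : ℝ := 1 + ∑ i, ∑ j, ∑ k, |m0 i j k|
    have hmm : ∀ i j k, m0 i j k ≤ m := by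
      intro i j k
      have a1 : |m0 i j k| ≤ ∑ k, |m0 i j k| :=
        Finset.single_le_sum (f := fun k => |m0 i j k|) (fun _ _ => abs_nonneg _) (Finset.mem_univ k)
      have a2 : ∑ k, |m0 i j k| ≤ ∑ j, ∑ k, |m0 i j k| :=
        Finset.single_le_sum (f := fun j => ∑ k, |m0 i j k|)
          (fun _ _ => Finset.sum_nonneg fun _ _ => abs_nonneg _) (Finset.mem_univ j)
      have a3 : ∑ j, ∑ k, |m0 i j k| ≤ ∑ i, ∑ j, ∑ k, |m0 i j k| :=
        Finset.single_le_sum (f := fun i => ∑ j, ∑ k, |m0 i j k|)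
          (fun _ _ => Finset.sum_nonneg fun _ _ => Finset.sum_nonneg fun _ _ => abs_nonneg _)
          (Finset.mem_univ i)
      have := le_abs_self (m0 i j k)
      simp only [m]; linarith
    refine ⟨m, by positivity, fun i j hij k => ?_⟩
    have ht : Tendsto (fun n => m • (A n (s n • y i) + A n (s n • y j)) - A n (s n • y k)) 𝒰
        (nhds (m • (Y i + Y j) - Y k)) := (((hY i).add (hY j)).const_smul m).sub (hY k)
    refine isClosed_closure.mem_of_tendsto ht (Filter.Eventually.of_forall fun n => ?_)
    have := hAc n _ (cone_closure_smul hUne hsm (hm0 i j k hij m (hmm i j k)) (hs n).le)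
    simpa only [map_add, map_sub, map_smul, smul_sub, smul_add, smul_comm (s n) m] using this
  · intro i m hm hcon
    have h1 : X + m • Y i ∈ U := by
      have := cone_open_add hU hadd hPU hcon
      convert this using 1; abel
    have ht : Tendsto (fun n => A n x + m • A n (s n • y i)) 𝒰 (nhds (X + m • Y i)) :=
      hX.add ((hY i).const_smul m)
    obtain ⟨n, hn⟩ := (ht.eventually (hU.mem_nhds h1)).exists
    have := hA2 n _ hn
    refine hxy i (m * s n) (mul_nonneg hm (hs n).le) ?_
    simpa only [map_add, map_smul, LinearEquiv.symm_apply_apply, smul_smul] using this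

end Core

theorem hilbert_cmp {d : ℕ} (O Cc F : Set (Fin d → ℝ)) (φ : (Fin d → ℝ) →ₗ[ℝ] ℝ) (σ : ℝ)
    (hadd : ∀ a ∈ Cc, ∀ b ∈ Cc, a + b ∈ Cc) (hsm : ∀ a ∈ Cc, ∀ c : ℝ, 0 ≤ c → c • a ∈ Cc)
    (hO : ∀ z, z ∈ O ↔ σ • z ∈ F ∧ φ z = 1) (hFC : F ⊆ Cc)
    (hFo : ∀ a ∈ F, ∀ b ∈ F, ∃ ε : ℝ, 0 < ε ∧ b + ε • (b - a) ∈ F)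
    (hbd : Bornology.IsBounded O) (u v : Fin d → ℝ) (hu : u ∈ O) (hv : v ∈ O) (R : ℝ) (hR : 0 < R)
    (hd : hilbertDistChart O u v < R) :
    Real.exp (2 * R) • (σ • v) - σ • u ∈ Cc ∧ Real.exp (2 * R) • (σ • u) - σ • v ∈ Cc := by
  set N := Real.exp (2 * R) with hN
  have hN1 : 1 < N := by rw [hN]; exact Real.one_lt_exp_iff.2 (by linarith)
  have huC : σ • u ∈ Cc := hFC ((hO u).1 hu).1
  have hvC : σ • v ∈ Cc := hFC ((hO v).1 hv).1
  by_cases huv : u = v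
  · subst huv
    have : N • (σ • u) - σ • u = (N - 1) • (σ • u) := by rw [sub_smul, one_smul]
    rw [this]
    exact ⟨hsm _ huC _ (by linarith), hsm _ huC _ (by linarith)⟩
  rw [hilbertDistChart, if_neg huv] at hd
  set S := {t : ℝ | u + t • (v - u) ∈ O} with hS
  obtain ⟨r, hr⟩ := hbd.exists_norm_le
  have hvu : 0 < ‖v - u‖ := norm_pos_iff.2 (sub_ne_zero.2 (Ne.symm huv))
  have habs : ∀ t ∈ S, |t| ≤ (r + ‖u‖) / ‖v - u‖ := by
    intro t ht
    rw [le_div_iff₀ hvu]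
    have h1 := hr _ ht
    have h2 : ‖t • (v - u)‖ ≤ ‖u + t • (v - u)‖ + ‖u‖ := by
      have := norm_sub_le (u + t • (v - u)) u
      simpa using this
    rw [norm_smul, Real.norm_eq_abs] at h2
    linarith
  have hba : BddAbove S := ⟨_, fun t ht => (abs_le.1 (habs t ht)).2⟩
  have hbb : BddBelow S := ⟨_, fun t ht => (abs_le.1 (habs t ht)).1⟩
  have hφu := ((hO u).1 hu).2
  have hφv := ((hO v).1 hv).2
  obtain ⟨ε1, he1, h1⟩ := hFo _ ((hO u).1 hu).1 _ ((hO v).1 hv).1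
  obtain ⟨ε2, he2, h2⟩ := hFo _ ((hO v).1 hv).1 _ ((hO u).1 hu).1
  have hm1 : 1 + ε1 ∈ S := by
    refine (hO _).2 ⟨?_, by simp [hφu, hφv]⟩
    convert h1 using 1; module
  have hm2 : -ε2 ∈ S := by
    refine (hO _).2 ⟨?_, by simp [hφu, hφv]⟩
    convert h2 using 1; module
  have hSne : S.Nonempty := ⟨_, hm1⟩
  have htp : 1 < sSup S := lt_of_lt_of_le (by linarith) (le_csSup hba hm1)
  have htm : sInf S < 0 := lt_of_le_of_lt (csInf_le hbb hm2) (by linarith)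
  set tp := sSup S
  set tm := sInf S
  have hden : 0 < (-tm) * (tp - 1) := mul_pos (by linarith) (by linarith)
  have hnum : 0 < tp * (1 - tm) := mul_pos (by linarith) (by linarith)
  have hlog : Real.log (tp * (1 - tm) / (-tm * (tp - 1))) < 2 * R := by linarith
  rw [Real.log_lt_iff_lt_exp (div_pos hnum hden), ← hN, div_lt_iff₀ hden] at hlog
  have k1 : tp < N * (tp - 1) := by
    have : (-tm) * tp < (-tm) * (N * (tp - 1)) := by nlinarith
    exact lt_of_mul_lt_mul_left this (by linarith)
  have k2 : 1 - tm < N * (-tm) := by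
    have : (tp - 1) * (1 - tm) < (tp - 1) * (N * (-tm)) := by nlinarith
    exact lt_of_mul_lt_mul_left this (by linarith)
  constructor
  · have : N / (N - 1) < tp := by rw [div_lt_iff₀ (by linarith)]; linarith
    obtain ⟨t, ht, htt⟩ := exists_lt_of_lt_csSup hSne this
    rw [div_lt_iff₀ (by linarith)] at htt
    have ht1 : 1 < t := by nlinarith
    have hc := hFC ((hO _).1 ht).1
    have e : N • (σ • v) - σ • u = (t - 1)⁻¹ • (σ • (u + t • (v - u))) +
        (N - t * (t - 1)⁻¹) • (σ • v) := by
      have : (t - 1) * (t - 1)⁻¹ = 1 := mul_inv_cancel₀ (by linarith)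
      have h' : t * (t - 1)⁻¹ = 1 + (t - 1)⁻¹ := by linarith
      rw [h']
      have e2 : (t - 1)⁻¹ • (σ • (u + t • (v - u))) =
        (t * (t - 1)⁻¹) • (σ • v) - ((t - 1) * (t - 1)⁻¹) • (σ • u) := by module
      rw [e2, this, h']; module
    rw [e]
    refine hadd _ (hsm _ hc _ (inv_nonneg.2 (by linarith))) _ (hsm _ hvC _ ?_)
    rw [sub_nonneg, ← div_eq_mul_inv, div_le_iff₀ (by linarith)]
    linarith
  · have : tm < -1 / (N - 1) := by rw [lt_div_iff₀ (by linarith)]; linarith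
    obtain ⟨t, ht, htt⟩ := exists_lt_of_csInf_lt hSne this
    rw [lt_div_iff₀ (by linarith)] at htt
    have ht1 : t < 0 := by nlinarith
    have hc := hFC ((hO _).1 ht).1
    have e : N • (σ • u) - σ • v = (-t)⁻¹ • (σ • (u + t • (v - u))) +
        (N - (1 - t) * (-t)⁻¹) • (σ • u) := by
      have h' : t * (-t)⁻¹ = -1 := by
        have : (-t) * (-t)⁻¹ = 1 := mul_inv_cancel₀ (by linarith)
        linarith
      have e2 : (-t)⁻¹ • (σ • (u + t • (v - u))) =
        (t * (-t)⁻¹) • (σ • v) + ((1 - t) * (-t)⁻¹) • (σ • u) := by module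
      rw [e2, h']; module
    rw [e]
    refine hadd _ (hsm _ hc _ (inv_nonneg.2 (by linarith))) _ (hsm _ huC _ ?_)
    rw [sub_nonneg, ← div_eq_mul_inv, div_le_iff₀ (by linarith)]
    linarith

theorem coarse {d : ℕ} (Cc : Set (Fin d → ℝ)) (hcl : IsClosed Cc)
    (hadd : ∀ a ∈ Cc, ∀ b ∈ Cc, a + b ∈ Cc) (hsm : ∀ a ∈ Cc, ∀ c : ℝ, 0 ≤ c → c • a ∈ Cc)
    (Y : Fin 3 → Fin d → ℝ) (hY : ∀ i, Y i ∈ Cc)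
    (m : ℝ) (hm0 : 0 < m) (hm : ∀ i j, i ≠ j → ∀ k, m • (Y i + Y j) - Y k ∈ Cc)
    (hnot : ∀ i, ∀ m : ℝ, 0 ≤ m → m • Y i - (Y 0 + Y 1 + Y 2) ∉ Cc)
    (φ : (Fin d → ℝ) →ₗ[ℝ] ℝ) (hφ : ∀ i, 0 < φ (Y i)) (N : ℝ) (hN : 0 < N) :
    ∃ ε : ℝ, 0 < ε ∧ ∀ (σ : ℝ) (z : Fin 3 → Fin d → ℝ), Collinear ℝ {z 0, z 1, z 2} →
      (∀ i, σ • z i ∈ Cc) →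
      (∀ i, N • (σ • z i) - (φ (Y i + ε • (Y 0 + Y 1 + Y 2)))⁻¹ • (Y i + ε • (Y 0 + Y 1 + Y 2)) ∈ Cc) →
      (∀ i, N • ((φ (Y i + ε • (Y 0 + Y 1 + Y 2)))⁻¹ • (Y i + ε • (Y 0 + Y 1 + Y 2))) - σ • z i ∈ Cc) →
      False := by
  set W := Y 0 + Y 1 + Y 2 with hW
  have hWC : W ∈ Cc := hadd _ (hadd _ (hY 0) _ (hY 1)) _ (hY 2)
  have hno : ∀ i j, i ≠ j → ∀ c : ℝ, 0 < c → Y i - c • Y j ∉ Cc := by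
    intro i j hij c hc h
    refine hnot i (3 * m * (1 + c⁻¹)) (by positivity) ?_
    have hk : ∀ k, (m * (1 + c⁻¹)) • Y i - Y k ∈ Cc := by
      intro k
      have e : (m * (1 + c⁻¹)) • Y i - Y k =
          (m • (Y i + Y j) - Y k) + (m * c⁻¹) • (Y i - c • Y j) := by
        have : c⁻¹ * c = 1 := inv_mul_cancel₀ hc.ne'
        have e2 : (m * c⁻¹) • (Y i - c • Y j) = (m * c⁻¹) • Y i - (m * (c⁻¹ * c)) • Y j := by module
        rw [e2, this]; module
      rw [e]
      exact hadd _ (hm i j hij k) _ (hsm _ h _ (by positivity))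
    have e : (3 * m * (1 + c⁻¹)) • Y i - W = ((m * (1 + c⁻¹)) • Y i - Y 0) +
      ((m * (1 + c⁻¹)) • Y i - Y 1) + ((m * (1 + c⁻¹)) • Y i - Y 2) := by
      rw [hW]; module
    rw [e]
    exact hadd _ (hadd _ (hk 0) _ (hk 1)) _ (hk 2)
  obtain ⟨a, ha, haY⟩ : ∃ a : ℝ, 0 < a ∧ ∀ i, a ≤ φ (Y i) := by
    refine ⟨min (φ (Y 0)) (min (φ (Y 1)) (φ (Y 2))), lt_min (hφ 0) (lt_min (hφ 1) (hφ 2)), ?_⟩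
    intro i
    fin_cases i
    · exact min_le_left _ _
    · exact (min_le_right _ _).trans (min_le_left _ _)
    · exact (min_le_right _ _).trans (min_le_right _ _)
  have hφW : φ W = φ (Y 0) + φ (Y 1) + φ (Y 2) := by rw [hW, map_add, map_add]
  have hφW0 : 0 < φ W := by rw [hφW]; linarith [hφ 0, hφ 1, hφ 2]
  have hYW : ∀ i, φ (Y i) ≤ φ W := by
    intro i; rw [hφW]
    have h0 := hφ 0
    have h1 := hφ 1
    have h2 := hφ 2
    fin_cases i <;> simp only [Fin.zero_eta, Fin.mk_one, Fin.reduceFinMk] <;> linarith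
  set c : ℝ := a / (2 * N ^ 2 * (2 * φ W)) with hc
  have hc0 : 0 < c := by positivity
  have hev : ∀ᶠ ε : ℝ in nhdsWithin 0 (Set.Ioi 0), ∀ i j, i ≠ j → Y i + ε • W - c • Y j ∉ Cc := by
    refine eventually_all.2 fun i => eventually_all.2 fun j => ?_
    by_cases hij : i = j
    · exact Eventually.of_forall fun _ h => absurd hij h
    have ht : Tendsto (fun ε : ℝ => Y i + ε • W - c • Y j) (nhdsWithin 0 (Set.Ioi 0))
        (nhds (Y i + (0 : ℝ) • W - c • Y j)) := by
      have : Continuous (fun ε : ℝ => Y i + ε • W - c • Y j) := by fun_prop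
      exact (this.tendsto 0).mono_left nhdsWithin_le_nhds
    have := ht.eventually (hcl.isOpen_compl.mem_nhds (by
      rw [zero_smul, add_zero]; exact hno i j hij c hc0))
    filter_upwards [this] with ε h _
    exact h
  have hev2 : ∀ᶠ ε : ℝ in nhdsWithin 0 (Set.Ioi 0), ε ≤ 1 :=
    nhdsWithin_le_nhds (eventually_le_nhds one_pos)
  obtain ⟨ε, ⟨he1, he2⟩, he3⟩ := ((hev.and hev2).and self_mem_nhdsWithin).exists
  have he3 : 0 < ε := he3
  refine ⟨ε, he3, ?_⟩
  intro σ z hcol hzC hA hB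
  have hφi : ∀ i, a ≤ φ (Y i + ε • W) ∧ φ (Y i + ε • W) ≤ 2 * φ W := by
    intro i
    simp only [map_add, map_smul, smul_eq_mul]
    constructor
    · nlinarith [haY i]
    · nlinarith [hYW i]
  -- key step
  have key : ∀ i l, i ≠ l → σ • z i - (1 / 2 : ℝ) • (σ • z l) ∈ Cc → False := by
    intro i l hil h
    refine he1 i l hil ?_
    obtain ⟨p1, p2⟩ := hφi i
    obtain ⟨q1, q2⟩ := hφi l
    set pi := φ (Y i + ε • W)
    set pl := φ (Y l + ε • W)
    have hpi : 0 < pi := by linarith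
    have hpl : 0 < pl := by linarith
    set κ : ℝ := pi / (2 * N ^ 2 * pl) with hκ
    have hcκ : c ≤ κ := by
      rw [hc, hκ]
      gcongr
    have h1 : (2 * N ^ 2) • (pi⁻¹ • (Y i + ε • W)) - pl⁻¹ • (Y l + ε • W) ∈ Cc := by
      have e : (2 * N ^ 2) • (pi⁻¹ • (Y i + ε • W)) - pl⁻¹ • (Y l + ε • W) =
        (2 * N) • (N • (pi⁻¹ • (Y i + ε • W)) - σ • z i) +
        (2 * N) • (σ • z i - (1 / 2 : ℝ) • (σ • z l)) +
        (N • (σ • z l) - pl⁻¹ • (Y l + ε • W)) := by module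
      rw [e]
      exact hadd _ (hadd _ (hsm _ (hB i) _ (by positivity)) _ (hsm _ h _ (by positivity))) _ (hA l)
    have h2 := hsm _ h1 (pi / (2 * N ^ 2)) (by positivity)
    have e2 : (pi / (2 * N ^ 2)) • ((2 * N ^ 2) • (pi⁻¹ • (Y i + ε • W)) - pl⁻¹ • (Y l + ε • W)) =
        (Y i + ε • W) - κ • (Y l + ε • W) := by
      rw [smul_sub, smul_smul, smul_smul, smul_smul]
      have a1 : pi / (2 * N ^ 2) * (2 * N ^ 2) * pi⁻¹ = 1 := by field_simp
      have a2 : pi / (2 * N ^ 2) * pl⁻¹ = κ := by rw [hκ]; field_simp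
      have a1' : pi / (2 * N ^ 2) * ((2 * N ^ 2) * pi⁻¹) = 1 := by field_simp
      rw [a1, a2, one_smul]
    rw [e2] at h2
    have e3 : Y i + ε • W - c • Y l = ((Y i + ε • W) - κ • (Y l + ε • W)) +
      ((κ - c) • Y l + (κ * ε) • W) := by module
    rw [e3]
    exact hadd _ h2 _ (hadd _ (hsm _ (hY l) _ (by linarith)) _
      (hsm _ hWC _ (mul_nonneg (by linarith) he3.le)))
  have btw : ∀ i j k, i ≠ j → i ≠ k → Wbtw ℝ (z j) (z i) (z k) → False := by
    rintro i j k hij hik ⟨t, ⟨ht0, ht1⟩, ht⟩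
    have e : σ • z i = (1 - t) • (σ • z j) + t • (σ • z k) := by
      rw [← ht, AffineMap.lineMap_apply_module]; module
    by_cases hh : t ≤ 1 / 2
    · refine key i j hij ?_
      have e2 : σ • z i - (1 / 2 : ℝ) • (σ • z j) = (1 / 2 - t) • (σ • z j) + t • (σ • z k) := by
        rw [e]; module
      rw [e2]
      exact hadd _ (hsm _ (hzC j) _ (by linarith)) _ (hsm _ (hzC k) _ ht0)
    · refine key i k hik ?_
      have e2 : σ • z i - (1 / 2 : ℝ) • (σ • z k) = (1 - t) • (σ • z j) + (t - 1 / 2) • (σ • z k) := by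
        rw [e]; module
      rw [e2]
      exact hadd _ (hsm _ (hzC j) _ (by linarith)) _ (hsm _ (hzC k) _ (by linarith))
  rcases hcol.wbtw_or_wbtw_or_wbtw with h | h | h
  · exact btw 1 0 2 (by decide) (by decide) h
  · exact btw 2 1 0 (by decide) (by decide) h
  · exact btw 0 2 1 (by decide) (by decide) h

theorem mk_openQuot (d : ℕ) : IsOpenQuotientMap
    (fun v : {v : Fin d → ℝ // v ≠ 0} => (Projectivization.mk ℝ v.1 v.2 : PSpace d)) := by
  have hq : Topology.IsQuotientMap
      (fun v : {v : Fin d → ℝ // v ≠ 0} => (Projectivization.mk ℝ v.1 v.2 : PSpace d)) :=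
    isQuotientMap_quot_mk
  refine ⟨hq.surjective, hq.continuous, ?_⟩
  intro s hs
  rw [← hq.isOpen_preimage]
  have : (fun v : {v : Fin d → ℝ // v ≠ 0} => (Projectivization.mk ℝ v.1 v.2 : PSpace d)) ⁻¹'
      ((fun v : {v : Fin d → ℝ // v ≠ 0} => (Projectivization.mk ℝ v.1 v.2 : PSpace d)) '' s) =
      ⋃ a : ℝˣ, (fun v : {v : Fin d → ℝ // v ≠ 0} =>
        (⟨a.1 • v.1, smul_ne_zero a.ne_zero v.2⟩ : {v : Fin d → ℝ // v ≠ 0})) ⁻¹' s := by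
    ext v
    simp only [Set.mem_preimage, Set.mem_image, Set.mem_iUnion]
    constructor
    · rintro ⟨u, hu, he⟩
      obtain ⟨a, ha⟩ := (Projectivization.mk_eq_mk_iff ℝ _ _ u.2 v.2).1 he
      refine ⟨a, ?_⟩
      convert hu using 1
      exact Subtype.ext ha
    · rintro ⟨a, ha⟩
      exact ⟨_, ha, (Projectivization.mk_eq_mk_iff ℝ _ _ _ v.2).2 ⟨a, rfl⟩⟩
  rw [this]
  refine isOpen_iUnion fun a => hs.preimage ?_
  exact Continuous.subtype_mk (by fun_prop) _

theorem chartMap_mk {d : ℕ} (f : (Fin d → ℝ) →ₗ[ℝ] ℝ) (v : Fin d → ℝ) (hv : v ≠ 0) :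
    chartMap f (Projectivization.mk ℝ v hv) = (f v)⁻¹ • v := by
  obtain ⟨a, ha⟩ := Projectivization.exists_smul_eq_mk_rep ℝ v hv
  rw [chartMap, ← ha, Units.smul_def, map_smul, smul_smul, smul_eq_mul, mul_inv, mul_comm, ← mul_assoc,
    mul_inv_cancel₀ a.ne_zero, one_mul]

theorem f_rep_mk {d : ℕ} (f : (Fin d → ℝ) →ₗ[ℝ] ℝ) (v : Fin d → ℝ) (hv : v ≠ 0) :
    f (Projectivization.mk ℝ v hv).rep ≠ 0 ↔ f v ≠ 0 := by
  obtain ⟨a, ha⟩ := Projectivization.exists_smul_eq_mk_rep ℝ v hv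
  rw [← ha, Units.smul_def, map_smul, smul_eq_mul]
  simp

theorem chartMap_ne {d : ℕ} {f : (Fin d → ℝ) →ₗ[ℝ] ℝ} {p : PSpace d} (h : f p.rep ≠ 0) :
    chartMap f p ≠ 0 := smul_ne_zero (inv_ne_zero h) p.rep_nonzero

theorem f_chartMap {d : ℕ} {f : (Fin d → ℝ) →ₗ[ℝ] ℝ} {p : PSpace d} (h : f p.rep ≠ 0) :
    f (chartMap f p) = 1 := by
  rw [chartMap, map_smul, smul_eq_mul, inv_mul_cancel₀ h]

theorem mk_chartMap {d : ℕ} {f : (Fin d → ℝ) →ₗ[ℝ] ℝ} {p : PSpace d} (h : f p.rep ≠ 0) :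
    Projectivization.mk ℝ (chartMap f p) (chartMap_ne h) = p := by
  conv_rhs => rw [← p.mk_rep]
  exact (Projectivization.mk_eq_mk_iff' ℝ _ _ _ _).2 ⟨_, rfl⟩

theorem mk_smul_eq {d : ℕ} (v : Fin d → ℝ) (hv : v ≠ 0) (c : ℝ) (h : c • v ≠ 0) :
    (Projectivization.mk ℝ (c • v) h : PSpace d) = Projectivization.mk ℝ v hv :=
  (Projectivization.mk_eq_mk_iff' ℝ _ _ _ _).2 ⟨_, rfl⟩

theorem chartMap_cont {d : ℕ} {f : (Fin d → ℝ) →ₗ[ℝ] ℝ} {p : PSpace d} (h : f p.rep ≠ 0) :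
    ContinuousAt (chartMap f) p := by
  rw [← p.mk_rep]
  have := (mk_openQuot d).continuousAt_comp_iff (g := chartMap f) (x := ⟨p.rep, p.rep_nonzero⟩)
  refine this.1 ?_
  have e : (chartMap f ∘ fun v : {v : Fin d → ℝ // v ≠ 0} =>
      (Projectivization.mk ℝ v.1 v.2 : PSpace d)) = fun v => (f v.1)⁻¹ • v.1 := by
    funext v; exact chartMap_mk f _ _
  rw [e]
  have hf : Continuous f := f.continuous_of_finiteDimensional
  exact ((hf.comp continuous_subtype_val).continuousAt.inv₀ h).smul
    continuous_subtype_val.continuousAt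

/-- The positive cone over `S` in the chart `f`. -/
def coneOver {d : ℕ} (f : (Fin d → ℝ) →ₗ[ℝ] ℝ) (S : Set (PSpace d)) : Set (Fin d → ℝ) :=
  {v | 0 < f v ∧ ∃ h : v ≠ 0, Projectivization.mk ℝ v h ∈ S}

theorem coneOver_open {d : ℕ} (f : (Fin d → ℝ) →ₗ[ℝ] ℝ) {S : Set (PSpace d)} (hS : IsOpen S) :
    IsOpen (coneOver f S) := by
  have h1 : IsOpen {v : Fin d → ℝ | 0 < f v} :=
    isOpen_lt continuous_const f.continuous_of_finiteDimensional
  have h2 : IsOpen (Subtype.val '' ((fun v : {v : Fin d → ℝ // v ≠ 0} =>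
      (Projectivization.mk ℝ v.1 v.2 : PSpace d)) ⁻¹' S)) :=
    (isOpen_compl_singleton (x := (0 : Fin d → ℝ))).isOpenMap_subtype_val _
      (hS.preimage (mk_openQuot d).continuous)
  convert h1.inter h2 using 1
  ext v
  simp [coneOver]

theorem mk_mem_closure {d : ℕ} {S : Set (PSpace d)} {T : Set (Fin d → ℝ)}
    (hT : ∀ v ∈ T, ∃ h : v ≠ 0, Projectivization.mk ℝ v h ∈ S) {v : Fin d → ℝ}
    (hv : v ∈ closure T) (h : v ≠ 0) : Projectivization.mk ℝ v h ∈ closure S := by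
  have h1 : (⟨v, h⟩ : {v : Fin d → ℝ // v ≠ 0}) ∈ closure (Subtype.val ⁻¹' T) := by
    rw [closure_subtype]
    convert hv using 2
    ext u
    constructor
    · rintro ⟨u', h, rfl⟩; exact h
    · intro hu; exact ⟨⟨u, (hT u hu).1⟩, hu, rfl⟩
  exact map_mem_closure (mk_openQuot d).continuous h1 (fun u hu => (hT _ hu).2)

theorem coneOver_chart {d : ℕ} {f : (Fin d → ℝ) →ₗ[ℝ] ℝ} {S : Set (PSpace d)} {p : PSpace d}
    (hp : p ∈ S) (h : f p.rep ≠ 0) : chartMap f p ∈ coneOver f S := by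
  refine ⟨by rw [f_chartMap h]; exact one_pos, chartMap_ne h, ?_⟩
  rw [mk_chartMap h]; exact hp

theorem coneOver_chart_closure {d : ℕ} {f : (Fin d → ℝ) →ₗ[ℝ] ℝ} {S : Set (PSpace d)}
    (hf : ∀ x ∈ closure S, f x.rep ≠ 0) {p : PSpace d}
    (hp : p ∈ closure S) : chartMap f p ∈ closure (coneOver f S) := by
  have h1 := (chartMap_cont (hf p hp)).continuousWithinAt.mem_closure_image hp
  refine closure_mono ?_ h1
  rintro _ ⟨q, hq, rfl⟩
  exact coneOver_chart hq (hf q (subset_closure hq))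

theorem coneOver_smul {d : ℕ} {f : (Fin d → ℝ) →ₗ[ℝ] ℝ} {S : Set (PSpace d)} :
    ∀ a ∈ coneOver f S, ∀ c : ℝ, 0 < c → c • a ∈ coneOver f S := by
  rintro a ⟨h1, h2, h3⟩ c hc
  refine ⟨by rw [map_smul]; exact mul_pos hc h1, smul_ne_zero hc.ne' h2, ?_⟩
  rw [mk_smul_eq a h2]; exact h3

theorem coneOver_add {d : ℕ} {f : (Fin d → ℝ) →ₗ[ℝ] ℝ} {S : Set (PSpace d)}
    (hf : ∀ x ∈ closure S, f x.rep ≠ 0) (hconv : Convex ℝ (chartMap f '' S)) :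
    ∀ a ∈ coneOver f S, ∀ b ∈ coneOver f S, a + b ∈ coneOver f S := by
  rintro a ⟨h1, h2, h3⟩ b ⟨k1, k2, k3⟩
  have ha : (f a)⁻¹ • a ∈ chartMap f '' S := ⟨_, h3, chartMap_mk f a h2⟩
  have hb : (f b)⁻¹ • b ∈ chartMap f '' S := ⟨_, k3, chartMap_mk f b k2⟩
  have := hconv ha hb (a := f a / (f a + f b)) (b := f b / (f a + f b)) (by positivity)
    (by positivity) (by field_simp)
  obtain ⟨p, hp, he⟩ := this
  have hh := coneOver_smul _ (coneOver_chart hp (hf p (subset_closure hp))) (f a + f b) (by positivity)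
  rw [he] at hh
  convert hh using 1
  rw [smul_add, smul_smul, smul_smul, smul_smul, smul_smul]
  have e1 : (f a + f b) * (f a / (f a + f b) * (f a)⁻¹) = 1 := by field_simp
  have e2 : (f a + f b) * (f b / (f a + f b) * (f b)⁻¹) = 1 := by field_simp
  have e1' : (f a + f b) * (f a / (f a + f b)) * (f a)⁻¹ = 1 := by field_simp
  have e2' : (f a + f b) * (f b / (f a + f b)) * (f b)⁻¹ = 1 := by field_simp
  first
    | rw [e1, e2, one_smul, one_smul]
    | rw [e1', e2', one_smul, one_smul]

theorem coneOver_bound {d : ℕ} {f : (Fin d → ℝ) →ₗ[ℝ] ℝ} {S : Set (PSpace d)}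
    (hb : Bornology.IsBounded (chartMap f '' S)) :
    ∃ M : ℝ, ∀ v ∈ closure (coneOver f S), ‖v‖ ≤ M * f v := by
  obtain ⟨M, hM⟩ := hb.exists_norm_le
  refine ⟨M, ?_⟩
  have hf : Continuous f := f.continuous_of_finiteDimensional
  have hcl : IsClosed {v : Fin d → ℝ | ‖v‖ ≤ M * f v} :=
    isClosed_le continuous_norm (continuous_const.mul hf)
  refine fun v hv => closure_minimal ?_ hcl hv
  rintro v ⟨h1, h2, h3⟩
  have := hM _ ⟨_, h3, chartMap_mk f v h2⟩
  rw [norm_smul, norm_inv, Real.norm_eq_abs, abs_of_pos h1, inv_mul_le_iff₀ h1] at this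
  simpa [mul_comm] using this

theorem coneOver_nonneg {d : ℕ} {f : (Fin d → ℝ) →ₗ[ℝ] ℝ} {S : Set (PSpace d)} :
    ∀ v ∈ closure (coneOver f S), 0 ≤ f v := by
  have hf : Continuous f := f.continuous_of_finiteDimensional
  exact fun v hv => closure_minimal (fun v hv => hv.1.le) (isClosed_le continuous_const hf) hv

theorem coneOver_act {d : ℕ} {f : (Fin d → ℝ) →ₗ[ℝ] ℝ} {Ω S : Set (PSpace d)} (hS : S ⊆ Ω)
    (hf : ∀ x ∈ closure Ω, f x.rep ≠ 0)
    (haddΩ : ∀ a ∈ coneOver f Ω, ∀ b ∈ coneOver f Ω, a + b ∈ coneOver f Ω)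
    (g : (Fin d → ℝ) ≃ₗ[ℝ] (Fin d → ℝ)) (hgΩ : pact g '' Ω = Ω) (hg : pact g '' S = S) (c : ℝ)
    (hc : c ≠ 0) (p : Fin d → ℝ) (hp : p ∈ coneOver f Ω) (hcp : 0 < f (c • g p)) :
    ∀ v ∈ coneOver f S, c • g v ∈ coneOver f S := by
  have hmk : ∀ T : Set (PSpace d), pact g '' T = T → ∀ v (h : v ≠ 0), Projectivization.mk ℝ v h ∈ T →
      ∃ h' : c • g v ≠ 0, Projectivization.mk ℝ (c • g v) h' ∈ T := by
    intro T hT v h hv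
    have h0 : g v ≠ 0 := by simpa using h
    refine ⟨smul_ne_zero hc h0, ?_⟩
    rw [mk_smul_eq _ h0, ← hT]
    exact ⟨_, hv, Projectivization.map_mk _ _ _ _⟩
  have hne : ∀ v ∈ coneOver f Ω, f (c • g v) ≠ 0 := by
    rintro v ⟨h1, h2, h3⟩
    obtain ⟨h4, h5⟩ := hmk Ω hgΩ v h2 h3
    exact (f_rep_mk f _ h4).1 (hf _ (subset_closure h5))
  rintro v ⟨h1, h2, h3⟩
  refine ⟨?_, hmk S hg v h2 h3⟩
  by_contra hneg
  have hvΩ : v ∈ coneOver f Ω := ⟨h1, h2, hS h3⟩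
  have hlt : f (c • g v) < 0 := lt_of_le_of_ne (not_lt.1 hneg) (hne v hvΩ)
  have := hne _ (haddΩ _ (coneOver_smul _ hvΩ _ hcp) _ (coneOver_smul _ hp _ (neg_pos.2 hlt)))
  apply this
  simp only [map_add, map_smul, smul_eq_mul]
  ring

/-- `Z` is dominated by a multiple of `X`. -/
def Dom {d : ℕ} (Cc : Set (Fin d → ℝ)) (X Z : Fin d → ℝ) : Prop := ∃ m : ℝ, 0 < m ∧ m • X - Z ∈ Cc

theorem Dom.scale {d : ℕ} {Cc : Set (Fin d → ℝ)}
    (hsm : ∀ a ∈ Cc, ∀ c : ℝ, 0 ≤ c → c • a ∈ Cc) {X Z : Fin d → ℝ} (h : Dom Cc X Z)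
    {α β : ℝ} (hα : 0 < α) (hβ : 0 < β) : Dom Cc (α • X) (β • Z) := by
  obtain ⟨m, hm, h⟩ := h
  refine ⟨m * β / α, by positivity, ?_⟩
  have := hsm _ h β hβ.le
  convert this using 1
  rw [smul_smul, smul_sub, smul_smul]
  congr 2
  field_simp

theorem Dom.trans {d : ℕ} {Cc : Set (Fin d → ℝ)}
    (hadd : ∀ a ∈ Cc, ∀ b ∈ Cc, a + b ∈ Cc)
    (hsm : ∀ a ∈ Cc, ∀ c : ℝ, 0 ≤ c → c • a ∈ Cc) {X Y Z : Fin d → ℝ} (h : Dom Cc X Y)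
    (h' : Dom Cc Y Z) : Dom Cc X Z := by
  obtain ⟨m, hm, h⟩ := h
  obtain ⟨n, hn, h'⟩ := h'
  refine ⟨n * m, by positivity, ?_⟩
  have e : (n * m) • X - Z = n • (m • X - Y) + (n • Y - Z) := by module
  rw [e]
  exact hadd _ (hsm _ h _ hn.le) _ h'

theorem face_iff {d : ℕ} {Ω : Set (PSpace d)} {f : (Fin d → ℝ) →ₗ[ℝ] ℝ} (hfe : cmap Ω = chartMap f)
    (hf : ∀ x ∈ closure Ω, f x.rep ≠ 0)
    (hadd : ∀ a ∈ closure (coneOver f Ω), ∀ b ∈ closure (coneOver f Ω), a + b ∈ closure (coneOver f Ω))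
    (hsm : ∀ a ∈ closure (coneOver f Ω), ∀ c : ℝ, 0 ≤ c → c • a ∈ closure (coneOver f Ω))
    (hpos : ∀ v ∈ closure (coneOver f Ω), v ≠ 0 → 0 < f v)
    (hmk : ∀ v ∈ closure (coneOver f Ω), ∀ h : v ≠ 0, Projectivization.mk ℝ v h ∈ closure Ω)
    {W v : Fin d → ℝ} (hWC : W ∈ closure (coneOver f Ω)) (hW0 : W ≠ 0)
    (hvC : v ∈ closure (coneOver f Ω)) (hv0 : v ≠ 0) :
    Projectivization.mk ℝ v hv0 ∈ face Ω (Projectivization.mk ℝ W hW0) ↔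
      Dom (closure (coneOver f Ω)) W v ∧ Dom (closure (coneOver f Ω)) v W := by
  set Cc := closure (coneOver f Ω)
  have hfW := hpos W hWC hW0
  have hfv := hpos v hvC hv0
  constructor
  · rintro (h | ⟨-, a, ha, b, hb, ⟨-, h1⟩, ⟨-, h2⟩⟩)
    · obtain ⟨a, ha⟩ := (Projectivization.mk_eq_mk_iff' ℝ _ _ _ _).1 h
      have ha0 : 0 < a := by
        have : a * f W = f v := by rw [← ha]; simp
        by_contra hcon
        nlinarith
      have hr : Dom Cc W W := ⟨1, one_pos, by simpa using hsm _ hWC 0 le_rfl⟩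
      have e1 := hr.scale hsm one_pos ha0
      have e2 := hr.scale hsm ha0 one_pos
      rw [ha, one_smul] at e1 e2
      exact ⟨e1, e2⟩
    · rw [hfe, chartMap_mk] at h1 h2
      have haC : chartMap f a ∈ Cc := coneOver_chart_closure hf ha
      have hbC : chartMap f b ∈ Cc := coneOver_chart_closure hf hb
      set A := chartMap f a
      set B := chartMap f b
      have hd : ∀ s t s' t' : ℝ, 0 < s → 0 < t → 0 < s' → 0 < t' →
          Dom Cc (s • A + t • B) (s' • A + t' • B) := by
        intro s t s' t' hs ht hs' ht'
        refine ⟨s' / s + t' / t, by positivity, ?_⟩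
        have e : (s' / s + t' / t) • (s • A + t • B) - (s' • A + t' • B) =
            (t' / t * s) • A + (s' / s * t) • B := by
          have a1 : s' / s * s = s' := by field_simp
          have a2 : t' / t * t = t' := by field_simp
          have : (s' / s + t' / t) • (s • A + t • B) =
            (s' / s * s + t' / t * s) • A + (s' / s * t + t' / t * t) • B := by module
          rw [this, a1, a2]; module
        rw [e]
        exact hadd _ (hsm _ haC _ (by positivity)) _ (hsm _ hbC _ (by positivity))
      obtain ⟨s, t, hs, ht, -, e1⟩ := h1
      obtain ⟨s', t', hs', ht', -, e2⟩ := h2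
      have hWe : W = f W • ((f W)⁻¹ • W) := by rw [smul_smul, mul_inv_cancel₀ hfW.ne', one_smul]
      have hve : v = f v • ((f v)⁻¹ • v) := by rw [smul_smul, mul_inv_cancel₀ hfv.ne', one_smul]
      rw [← e1] at hWe
      rw [← e2] at hve
      constructor
      · have := (hd s t s' t' hs ht hs' ht').scale hsm hfW hfv
        rwa [← hWe, ← hve] at this
      · have := (hd s' t' s t hs' ht' hs ht).scale hsm hfv hfW
        rwa [← hWe, ← hve] at this
  · rintro ⟨h1, h2⟩
    obtain ⟨m1, hm1, h1⟩ := h1.scale hsm (inv_pos.2 hfW) (inv_pos.2 hfv)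
    obtain ⟨m2, hm2, h2⟩ := h2.scale hsm (inv_pos.2 hfv) (inv_pos.2 hfW)
    have hWC' := hsm _ hWC _ (inv_pos.2 hfW).le
    have hvC' := hsm _ hvC _ (inv_pos.2 hfv).le
    have hfW' : f ((f W)⁻¹ • W) = 1 := by rw [map_smul, smul_eq_mul, inv_mul_cancel₀ hfW.ne']
    have hfv' : f ((f v)⁻¹ • v) = 1 := by rw [map_smul, smul_eq_mul, inv_mul_cancel₀ hfv.ne']
    have cW := chartMap_mk f W hW0
    have cv := chartMap_mk f v hv0
    set W' := (f W)⁻¹ • W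
    set v' := (f v)⁻¹ • v
    set ε := (m1 + m2)⁻¹ with hε
    have hε0 : 0 < ε := by positivity
    have hεm : ε * m1 + ε * m2 = 1 := by rw [← mul_add, hε, inv_mul_cancel₀ (by positivity)]
    have haC : (1 + ε) • W' - ε • v' ∈ Cc := by
      have e : (1 + ε) • W' - ε • v' = ε • (m1 • W' - v') + (ε + ε * m2) • W' := by
        have : (1 : ℝ) + ε = ε * m1 + ε * m2 + ε := by rw [hεm]
        rw [this]; module
      rw [e]
      exact hadd _ (hsm _ h1 _ hε0.le) _ (hsm _ hWC' _ (by positivity))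
    have hbC : (1 + ε) • v' - ε • W' ∈ Cc := by
      have e : (1 + ε) • v' - ε • W' = ε • (m2 • v' - W') + (ε + ε * m1) • v' := by
        have : (1 : ℝ) + ε = ε * m1 + ε * m2 + ε := by rw [hεm]
        rw [this]; module
      rw [e]
      exact hadd _ (hsm _ h2 _ hε0.le) _ (hsm _ hvC' _ (by positivity))
    have hfa : f ((1 + ε) • W' - ε • v') = 1 := by simp [hfW', hfv']
    have hfb : f ((1 + ε) • v' - ε • W') = 1 := by simp [hfW', hfv']
    have ha0 : (1 + ε) • W' - ε • v' ≠ 0 := by intro h; rw [h] at hfa; simp at hfa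
    have hb0 : (1 + ε) • v' - ε • W' ≠ 0 := by intro h; rw [h] at hfb; simp at hfb
    have ca := chartMap_mk f _ ha0
    have cb := chartMap_mk f _ hb0
    rw [hfa, inv_one, one_smul] at ca
    rw [hfb, inv_one, one_smul] at cb
    have h12 : (0 : ℝ) < 1 + 2 * ε := by positivity
    have k1 : (1 + ε) / (1 + 2 * ε) * (1 + ε) - ε / (1 + 2 * ε) * ε = 1 := by field_simp; ring
    have k2 : ε / (1 + 2 * ε) * (1 + ε) - (1 + ε) / (1 + 2 * ε) * ε = 0 := by field_simp; ring
    refine Or.inr ⟨hmk v hvC hv0, Projectivization.mk ℝ _ ha0, hmk _ haC ha0,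
      Projectivization.mk ℝ _ hb0, hmk _ hbC hb0, ⟨hmk _ hWC hW0, ?_⟩, ⟨hmk _ hvC hv0, ?_⟩⟩
    · rw [hfe, ca, cb, cW]
      refine ⟨(1 + ε) / (1 + 2 * ε), ε / (1 + 2 * ε), by positivity, by positivity, by field_simp; ring, ?_⟩
      have : ((1 + ε) / (1 + 2 * ε)) • ((1 + ε) • W' - ε • v') + (ε / (1 + 2 * ε)) • ((1 + ε) • v' - ε • W') =
        ((1 + ε) / (1 + 2 * ε) * (1 + ε) - ε / (1 + 2 * ε) * ε) • W' +
        (ε / (1 + 2 * ε) * (1 + ε) - (1 + ε) / (1 + 2 * ε) * ε) • v' := by module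
      rw [this, k1, k2]; simp
    · rw [hfe, ca, cb, cv]
      refine ⟨ε / (1 + 2 * ε), (1 + ε) / (1 + 2 * ε), by positivity, by positivity, by field_simp; ring, ?_⟩
      have : (ε / (1 + 2 * ε)) • ((1 + ε) • W' - ε • v') + ((1 + ε) / (1 + 2 * ε)) • ((1 + ε) • v' - ε • W') =
        ((1 + ε) / (1 + 2 * ε) * (1 + ε) - ε / (1 + 2 * ε) * ε) • v' +
        (ε / (1 + 2 * ε) * (1 + ε) - (1 + ε) / (1 + 2 * ε) * ε) • W' := by module
      rw [this, k1, k2]; simp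

/-- Proposition 4.4: a configuration of four points in the ideal boundary of a
naive convex co-compact triple, with three sides in `∂Ω` from `x` and a triangle of open
segments in `Ω`, forces a face of coarse dimension at least two. -/
theorem finding_two_dimensional_faces {d : ℕ} (T : NCCTriple d)
    (x y₁ y₂ y₃ : PSpace d)
    (hx : x ∈ idealBdry T.C) (h1 : y₁ ∈ idealBdry T.C) (h2 : y₂ ∈ idealBdry T.C)
    (h3 : y₃ ∈ idealBdry T.C)
    (hxy1 : x ≠ y₁) (hxy2 : x ≠ y₂) (hxy3 : x ≠ y₃)
    (h12 : y₁ ≠ y₂) (h23 : y₂ ≠ y₃) (h13 : y₁ ≠ y₃)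
    (hseg1 : projSeg T.Ω x y₁ ⊆ closure T.Ω \ T.Ω)
    (hseg2 : projSeg T.Ω x y₂ ⊆ closure T.Ω \ T.Ω)
    (hseg3 : projSeg T.Ω x y₃ ⊆ closure T.Ω \ T.Ω)
    (ho12 : projOpenSeg T.Ω y₁ y₂ ⊆ T.Ω)
    (ho23 : projOpenSeg T.Ω y₂ y₃ ⊆ T.Ω)
    (ho31 : projOpenSeg T.Ω y₃ y₁ ⊆ T.Ω) :
    ∃ w ∈ idealBdry T.C, 2 ≤ cdim (face T.Ω w) (idealBdry T.C ∩ face T.Ω w) := by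
  classical
  obtain ⟨Ω, C, Λ, oΩ, _, pcΩ, invΩ, _, _, _, CΩ, Ccl, Cconv, invC, K, hKC, hKcpt, hKcov⟩ := T
  dsimp only at *
  -- the chart of Ω
  set f := chartOf Ω with hfdef
  have hfe : cmap Ω = chartMap f := rfl
  obtain ⟨hf, hconv, hbdd⟩ : (∀ x ∈ closure Ω, f x.rep ≠ 0) ∧
      Convex ℝ (chartMap f '' Ω) ∧ Bornology.IsBounded (chartMap f '' Ω) := by
    have : f = pcΩ.choose := by rw [hfdef, chartOf, dif_pos pcΩ]
    rw [this]; exact pcΩ.choose_spec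
  have hCcl : closure C ⊆ closure Ω := closure_mono CΩ
  have hfC : ∀ x ∈ closure C, f x.rep ≠ 0 := fun x hx => hf x (hCcl hx)
  set U := coneOver f Ω with hUdef
  set D := coneOver f C with hDdef
  have hU : IsOpen U := coneOver_open f oΩ
  have hadd : ∀ a ∈ U, ∀ b ∈ U, a + b ∈ U := coneOver_add hf hconv
  have hsm : ∀ a ∈ U, ∀ c : ℝ, 0 < c → c • a ∈ U := coneOver_smul
  have haddD : ∀ a ∈ D, ∀ b ∈ D, a + b ∈ D := coneOver_add hfC Cconv
  have hsmD : ∀ a ∈ D, ∀ c : ℝ, 0 < c → c • a ∈ D := coneOver_smul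
  obtain ⟨M, hM⟩ := coneOver_bound hbdd
  have hf0 : ∀ v ∈ closure U, 0 ≤ f v := coneOver_nonneg
  have hDU : D ⊆ U := fun v hv => ⟨hv.1, hv.2.1, CΩ hv.2.2⟩
  have hDcU : closure D ⊆ closure U := closure_mono hDU
  have hpos : ∀ v ∈ closure U, v ≠ 0 → 0 < f v := by
    intro v hv h0
    refine lt_of_le_of_ne (hf0 v hv) fun h => h0 ?_
    have := hM v hv
    rw [← h, mul_zero] at this
    exact norm_le_zero_iff.1 this
  have hmk : ∀ v ∈ closure U, ∀ h : v ≠ 0, Projectivization.mk ℝ v h ∈ closure Ω :=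
    fun v hv h => mk_mem_closure (fun u hu => hu.2) hv h
  have hmkC : ∀ v ∈ closure D, ∀ h : v ≠ 0, Projectivization.mk ℝ v h ∈ closure C :=
    fun v hv h => mk_mem_closure (fun u hu => hu.2) hv h
  have hclD : closure D ∩ U ⊆ D := by
    rintro v ⟨hv, hvU⟩
    exact ⟨hvU.1, hvU.2.1, Ccl ⟨hmkC v hv hvU.2.1, hvU.2.2⟩⟩
  have hco : ∀ p ∈ D, ∃ A : (Fin d → ℝ) ≃ₗ[ℝ] (Fin d → ℝ), (∀ v ∈ U, A v ∈ U) ∧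
      (∀ v ∈ U, A.symm v ∈ U) ∧ (∀ v ∈ D, A v ∈ D) ∧ A p ∈ chartMap f '' K := by
    rintro p ⟨hp1, hp2, hp3⟩
    have hpU : p ∈ U := ⟨hp1, hp2, CΩ hp3⟩
    have := hKcov hp3
    simp only [Set.mem_iUnion] at this
    obtain ⟨g, hg, k, hk, hgk⟩ := this
    have hginv : g⁻¹ ∈ Λ := Λ.inv_mem hg
    have hh0 : g⁻¹ p ≠ 0 := by
      intro h; exact hp2 ((LinearEquiv.map_eq_zero_iff g⁻¹).1 h)
    have hkeq : k = Projectivization.mk ℝ (g⁻¹ p) hh0 := by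
      have h1 : pact g (Projectivization.mk ℝ (g⁻¹ p) hh0) = pact g k := by
        rw [hgk, pact, Projectivization.map_mk]
        congr 1
        exact g.apply_symm_apply p
      exact (Projectivization.map_injective _ _ h1).symm
    have hne : f (g⁻¹ p) ≠ 0 := by
      have := hf k (subset_closure (CΩ (hKC hk)))
      rw [hkeq, f_rep_mk] at this
      exact this
    have hc : (f (g⁻¹ p))⁻¹ ≠ 0 := inv_ne_zero hne
    have hcp : 0 < f ((f (g⁻¹ p))⁻¹ • g⁻¹ p) := by
      rw [map_smul, smul_eq_mul, inv_mul_cancel₀ hne]; exact one_pos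
    have hA : ∀ v ∈ U, (f (g⁻¹ p))⁻¹ • g⁻¹ v ∈ U :=
      coneOver_act (Subset.refl Ω) hf hadd g⁻¹ (invΩ _ hginv) (invΩ _ hginv) _ hc p hpU hcp
    have hAD : ∀ v ∈ D, (f (g⁻¹ p))⁻¹ • g⁻¹ v ∈ D :=
      coneOver_act CΩ hf hadd g⁻¹ (invΩ _ hginv) (invC _ hginv) _ hc p hpU hcp
    have hgg : ∀ v, g (g⁻¹ v) = v := fun v => g.apply_symm_apply v
    have hA2 : ∀ v ∈ U, f (g⁻¹ p) • g v ∈ U := by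
      refine coneOver_act (Subset.refl Ω) hf hadd g (invΩ _ hg) (invΩ _ hg) _ hne _ (hA p hpU) ?_
      rw [map_smul g, hgg, smul_smul, mul_inv_cancel₀ hne, one_smul]
      exact hp1
    refine ⟨LinearEquiv.trans g⁻¹ (LinearEquiv.smulOfNeZero ℝ (Fin d → ℝ) _ hc), ?_, ?_, ?_, ?_⟩
    · intro v hv; exact hA v hv
    · intro v hv
      have e : (LinearEquiv.trans g⁻¹ (LinearEquiv.smulOfNeZero ℝ (Fin d → ℝ) _ hc)).symm v =
          f (g⁻¹ p) • g v := by
        rw [LinearEquiv.symm_apply_eq]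
        change v = (f (g⁻¹ p))⁻¹ • g⁻¹ (f (g⁻¹ p) • g v)
        have : g⁻¹ (g v) = v := g.symm_apply_apply v
        rw [map_smul, this, smul_smul, inv_mul_cancel₀ hne, one_smul]
      rw [e]; exact hA2 v hv
    · intro v hv; exact hAD v hv
    · refine ⟨k, hk, ?_⟩
      rw [hkeq, chartMap_mk]; rfl
  have hKcpt' : IsCompact (chartMap f '' K) := hKcpt.image_of_continuousOn fun k hk =>
    (chartMap_cont (hf k (subset_closure (CΩ (hKC hk))))).continuousWithinAt
  have hKD : chartMap f '' K ⊆ D := by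
    rintro _ ⟨k, hk, rfl⟩
    exact coneOver_chart (hKC hk) (hf k (subset_closure (CΩ (hKC hk))))
  have hpt : ∀ p ∈ idealBdry C, f p.rep ≠ 0 ∧ chartMap f p ∈ closure D := fun p hp =>
    ⟨hfC p hp.1, coneOver_chart_closure hfC hp.1⟩
  have hsegaux : ∀ p ∈ idealBdry C, projSeg Ω x p ⊆ closure Ω \ Ω →
      ∀ s : ℝ, 0 ≤ s → chartMap f x + s • chartMap f p ∉ U := by
    intro p hp hseg s hs hmem
    obtain ⟨h1, h2, h3⟩ := hmem
    have hfx := f_chartMap (hpt x hx).1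
    have hfp := f_chartMap (hpt p hp).1
    refine (hseg (a := Projectivization.mk ℝ _ h2) ⟨subset_closure h3, ?_⟩).2 h3
    rw [hfe, chartMap_mk]
    have e : f (chartMap f x + s • chartMap f p) = 1 + s := by simp [hfx, hfp]
    rw [e]
    have hs1 : 0 < 1 + s := by positivity
    refine ⟨(1 + s)⁻¹, (1 + s)⁻¹ * s, by positivity, by positivity, by field_simp, ?_⟩
    rw [smul_add, smul_smul]
  have hopaux : ∀ p ∈ idealBdry C, ∀ q ∈ idealBdry C, projOpenSeg Ω p q ⊆ Ω →
      chartMap f p + chartMap f q ∈ U := by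
    intro p hp q hq hseg
    have hfp := f_chartMap (hpt p hp).1
    have hfq := f_chartMap (hpt q hq).1
    have e : f (chartMap f p + chartMap f q) = 2 := by rw [map_add, hfp, hfq]; norm_num
    have h0 : chartMap f p + chartMap f q ≠ 0 := by intro h; rw [h] at e; simp at e
    have hmem := cone_closure_add hadd (hDcU (hpt p hp).2) (hDcU (hpt q hq).2)
    refine ⟨by rw [e]; norm_num, h0, hseg ⟨hmk _ hmem h0, ?_⟩⟩
    rw [hfe, chartMap_mk, e]
    refine ⟨1 / 2, 1 / 2, by norm_num, by norm_num, by norm_num, ?_⟩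
    rw [smul_add]; norm_num
  obtain ⟨Y, hYD, hWU, ⟨m, hm0, hm⟩, hnot⟩ := core (U := U) (D := D) f M hU hadd hsm hM hf0 hDU haddD
    hsmD hclD hKcpt' hKD hco (chartMap f x) ![chartMap f y₁, chartMap f y₂, chartMap f y₃]
    (hpt x hx).2
    (by
      intro i
      fin_cases i
      · exact (hpt _ h1).2
      · exact (hpt _ h2).2
      · exact (hpt _ h3).2)
    (chartMap_ne (hpt x hx).1)
    (by
      intro i
      fin_cases i
      · exact hsegaux _ h1 hseg1
      · exact hsegaux _ h2 hseg2
      · exact hsegaux _ h3 hseg3)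
    (by
      have a12 := hopaux _ h1 _ h2 ho12
      have a23 := hopaux _ h2 _ h3 ho23
      have a31 := hopaux _ h3 _ h1 ho31
      have a21 := a12
      have a32 := a23
      have a13 := a31
      rw [add_comm] at a21 a32 a13
      intro i j hij
      fin_cases i <;> fin_cases j <;> first
        | exact absurd rfl hij
        | exact a12
        | exact a23
        | exact a31
        | exact a21
        | exact a32
        | exact a13)
  -- the closed cone
  have hUne : U.Nonempty := ⟨_, hopaux _ h1 _ h2 ho12⟩
  have hDne : D.Nonempty := by
    obtain ⟨⟨z, hz⟩⟩ : Nonempty (closure D) := ⟨⟨_, hYD 0⟩⟩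
    exact closure_nonempty_iff.1 ⟨z, hz⟩
  set Cc := closure U with hCc
  have haddC : ∀ a ∈ Cc, ∀ b ∈ Cc, a + b ∈ Cc := fun a ha b hb => cone_closure_add hadd ha hb
  have hsmC : ∀ a ∈ Cc, ∀ c : ℝ, 0 ≤ c → c • a ∈ Cc := fun a ha c hc =>
    cone_closure_smul hUne hsm ha hc
  have hYC : ∀ i, Y i ∈ Cc := fun i => hDcU (hYD i)
  set W := Y 0 + Y 1 + Y 2 with hW
  have hWD : W ∈ closure D :=
    cone_closure_add haddD (cone_closure_add haddD (hYD 0) (hYD 1)) (hYD 2)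
  have hWC : W ∈ Cc := hDcU hWD
  have h0C : (0 : Fin d → ℝ) ∈ Cc := by simpa using hsmC _ hWC 0 le_rfl
  have hWY : ∀ i, W - Y i ∈ Cc := by
    intro i
    have a0 := haddC _ (hYC 1) _ (hYC 2)
    have a1 := haddC _ (hYC 0) _ (hYC 2)
    have a2 := haddC _ (hYC 0) _ (hYC 1)
    fin_cases i
    · convert a0 using 1; simp only [Fin.zero_eta, hW]; abel
    · convert a1 using 1; simp only [Fin.mk_one, hW]; abel
    · convert a2 using 1; simp only [Fin.reduceFinMk, hW]; abel
  have hW0 : W ≠ 0 := by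
    intro h
    refine hnot 0 0 le_rfl ?_
    rw [h]; simpa using h0C
  have hfW := hpos W hWC hW0
  have hY0 : ∀ i, Y i ≠ 0 := by
    have aux : ∀ i j, i ≠ j → Y i ≠ 0 := by
      intro i j hij h
      have h3 : ∀ k, m • Y j - Y k ∈ Cc := fun k => by simpa [h] using hm i j hij k
      refine hnot j (3 * m) (by positivity) ?_
      have e : (3 * m) • Y j - W = (m • Y j - Y 0) + (m • Y j - Y 1) + (m • Y j - Y 2) := by
        rw [hW]; module
      rw [e]
      exact haddC _ (haddC _ (h3 0) _ (h3 1)) _ (h3 2)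
    intro i
    exact aux i (i + 1) (by fin_cases i <;> decide)
  -- the point and its face
  set w : PSpace d := Projectivization.mk ℝ W hW0 with hw
  set F := face Ω w with hF
  have hiff : ∀ v ∈ Cc, ∀ h : v ≠ 0, (Projectivization.mk ℝ v h ∈ F ↔ Dom Cc W v ∧ Dom Cc v W) :=
    fun v hv h => face_iff hfe hf haddC hsmC hpos hmk hWC hW0 hv h
  have hFΩ : F ⊆ closure Ω := by
    rintro p (rfl | h)
    · exact hmk W hWC hW0
    · exact h.1
  set FC : Set (Fin d → ℝ) := {v | v ∈ Cc ∧ Dom Cc W v ∧ Dom Cc v W} with hFC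
  have hFC0 : ∀ v ∈ FC, v ≠ 0 := by
    rintro v ⟨-, -, n, hn, h⟩ rfl
    have := hf0 _ h
    simp only [smul_zero, zero_sub, map_neg] at this
    linarith
  have hFCmk : ∀ v (hv : v ∈ FC), Projectivization.mk ℝ v (hFC0 v hv) ∈ F := fun v hv =>
    (hiff v hv.1 _).2 hv.2
  have hFrep : ∀ p ∈ F, ∃ v, ∃ hv : v ∈ FC, p = Projectivization.mk ℝ v (hFC0 v hv) := by
    intro p hp
    have hp' := hFΩ hp
    have hc : chartMap f p ∈ Cc := coneOver_chart_closure hf hp'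
    have hmem : chartMap f p ∈ FC := by
      refine ⟨hc, (hiff _ hc (chartMap_ne (hf p hp'))).1 ?_⟩
      rw [mk_chartMap (hf p hp')]; exact hp
    exact ⟨_, hmem, (mk_chartMap (hf p hp')).symm⟩
  have hFCsm : ∀ v ∈ FC, ∀ c : ℝ, 0 < c → c • v ∈ FC := by
    rintro v ⟨a1, a2, a3⟩ c hc
    refine ⟨hsmC _ a1 _ hc.le, ?_, ?_⟩
    · simpa using a2.scale hsmC one_pos hc
    · simpa using a3.scale hsmC hc one_pos
  have hFCadd : ∀ v ∈ FC, ∀ u ∈ FC, v + u ∈ FC := by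
    rintro v ⟨a1, ⟨n, hn, a2⟩, ⟨n', hn', a3⟩⟩ u ⟨b1, ⟨k, hk, b2⟩, -⟩
    refine ⟨haddC _ a1 _ b1, ⟨n + k, by positivity, ?_⟩, ⟨n', hn', ?_⟩⟩
    · have e : (n + k) • W - (v + u) = (n • W - v) + (k • W - u) := by module
      rw [e]; exact haddC _ a2 _ b2
    · have e : n' • (v + u) - W = (n' • v - W) + n' • u := by module
      rw [e]; exact haddC _ a3 _ (hsmC _ b1 _ hn'.le)
  have hFCo : ∀ a ∈ FC, ∀ b ∈ FC, ∃ ε : ℝ, 0 < ε ∧ b + ε • (b - a) ∈ FC := by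
    rintro a ⟨a1, a2, a3⟩ b ⟨b1, b2, b3⟩
    obtain ⟨n, hn, hab⟩ := b3.trans haddC hsmC a2
    have hεn : n⁻¹ * n = 1 := inv_mul_cancel₀ hn.ne'
    have hin : n⁻¹ • b ∈ FC := hFCsm b ⟨b1, b2, b3⟩ _ (by positivity)
    obtain ⟨-, ⟨k, hk, c1⟩, ⟨l, hl, c2⟩⟩ := hin
    have e : b + n⁻¹ • (b - a) = n⁻¹ • (n • b - a) + n⁻¹ • b := by
      have : n⁻¹ • (n • b - a) = (n⁻¹ * n) • b - n⁻¹ • a := by module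
      rw [this, hεn]; module
    have hx := hsmC _ hab _ (inv_pos.2 hn).le
    refine ⟨n⁻¹, by positivity, ?_, ?_, ?_⟩
    · rw [e]; exact haddC _ hx _ (hsmC _ b1 _ (inv_pos.2 hn).le)
    · obtain ⟨q, hq, hqb⟩ := b2
      refine ⟨(1 + n⁻¹) * q, by positivity, ?_⟩
      have e2 : ((1 + n⁻¹) * q) • W - (b + n⁻¹ • (b - a)) =
        (1 + n⁻¹) • (q • W - b) + n⁻¹ • a := by module
      rw [e2]
      exact haddC _ (hsmC _ hqb _ (by positivity)) _ (hsmC _ a1 _ (by positivity))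
    · refine ⟨l, hl, ?_⟩
      rw [e]
      have e2 : l • (n⁻¹ • (n • b - a) + n⁻¹ • b) - W =
        l • (n⁻¹ • (n • b - a)) + (l • n⁻¹ • b - W) := by module
      rw [e2]
      exact haddC _ (hsmC _ hx _ hl.le) _ c2
  have hWFC : W ∈ FC := by
    refine ⟨hWC, ⟨1, one_pos, ?_⟩, ⟨1, one_pos, ?_⟩⟩ <;> simpa using h0C
  -- F is properly convex
  have hFclΩ : closure F ⊆ closure Ω := closure_minimal hFΩ isClosed_closure
  have hPC : IsProperlyConvex F := by
    refine ⟨f, fun p hp => hf p (hFclΩ hp), ?_, ?_⟩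
    · rintro _ ⟨p, hp, rfl⟩ _ ⟨q, hq, rfl⟩ s t hs ht hst
      rcases hs.eq_or_lt with rfl | hs
      · have : t = 1 := by linarith
        subst this; exact ⟨q, hq, by simp⟩
      rcases ht.eq_or_lt with rfl | ht
      · have : s = 1 := by linarith
        subst this; exact ⟨p, hp, by simp⟩
      have hpF : ∀ r ∈ F, chartMap f r ∈ FC := by
        intro r hr
        obtain ⟨v, hv, rfl⟩ := hFrep r hr
        rw [chartMap_mk]
        exact hFCsm v hv _ (inv_pos.2 (hpos v hv.1 (hFC0 v hv)))
      have hmem := hFCadd _ (hFCsm _ (hpF p hp) s hs) _ (hFCsm _ (hpF q hq) t ht)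
      refine ⟨_, hFCmk _ hmem, ?_⟩
      rw [chartMap_mk, map_add, map_smul, map_smul, f_chartMap (hf p (hFΩ hp)),
        f_chartMap (hf q (hFΩ hq))]
      simp [hst]
    · have hM' : ∀ p ∈ F, ‖chartMap f p‖ ≤ M := by
        intro p hp
        have := hM _ (coneOver_chart_closure hf (hFΩ hp))
        rwa [f_chartMap (hf p (hFΩ hp)), mul_one] at this
      refine isBounded_iff_forall_norm_le.2 ⟨M, ?_⟩
      rintro _ ⟨p, hp, rfl⟩
      exact hM' p hp
  set f1 := chartOf F with hf1def
  have hfe1 : cmap F = chartMap f1 := rfl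
  obtain ⟨hf1, hconv1, hbdd1⟩ : (∀ x ∈ closure F, f1 x.rep ≠ 0) ∧
      Convex ℝ (chartMap f1 '' F) ∧ Bornology.IsBounded (chartMap f1 '' F) := by
    have : f1 = hPC.choose := by rw [hf1def, chartOf, dif_pos hPC]
    rw [this]; exact hPC.choose_spec
  have hf1ne : ∀ v ∈ FC, f1 v ≠ 0 := fun v hv =>
    (f_rep_mk f1 v (hFC0 v hv)).1 (hf1 _ (subset_closure (hFCmk v hv)))
  obtain ⟨σ, hσ2, hσW⟩ : ∃ σ : ℝ, σ * σ = 1 ∧ 0 < σ * f1 W := by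
    rcases lt_or_gt_of_ne (hf1ne W hWFC) with h | h
    · exact ⟨-1, by norm_num, by linarith⟩
    · exact ⟨1, by norm_num, by linarith⟩
  have hσpos : ∀ v ∈ FC, 0 < σ * f1 v := by
    intro v hv
    by_contra hcon
    have hne : σ * f1 v ≠ 0 := mul_ne_zero (by rintro rfl; simp at hσ2) (hf1ne v hv)
    have hlt : σ * f1 v < 0 := lt_of_le_of_ne (not_lt.1 hcon) hne
    refine hf1ne _ (hFCadd _ (hFCsm v hv _ hσW) _ (hFCsm W hWFC _ (neg_pos.2 hlt))) ?_
    simp only [map_add, map_smul, smul_eq_mul]; ring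
  have hσσ : ∀ z : Fin d → ℝ, σ • (σ • z) = z := fun z => by rw [smul_smul, hσ2, one_smul]
  have hO : ∀ z, z ∈ cmap F '' F ↔ σ • z ∈ FC ∧ f1 z = 1 := by
    intro z
    constructor
    · rintro ⟨p, hp, rfl⟩
      obtain ⟨v, hv, rfl⟩ := hFrep p hp
      rw [hfe1, chartMap_mk]
      refine ⟨?_, by rw [map_smul, smul_eq_mul, inv_mul_cancel₀ (hf1ne v hv)]⟩
      rw [smul_smul]
      refine hFCsm v hv _ ?_
      have hh := hσpos v hv
      have e : σ * (f1 v)⁻¹ = (σ * f1 v)⁻¹ := by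
        rw [mul_inv]
        congr 1
        exact eq_inv_of_mul_eq_one_left hσ2
      rw [e]; exact inv_pos.2 hh
    · rintro ⟨hz, hz1⟩
      refine ⟨_, hFCmk _ hz, ?_⟩
      rw [hfe1, chartMap_mk, map_smul, hz1, smul_eq_mul, mul_one, smul_smul]
      rw [inv_mul_cancel₀ (by rintro rfl; simp at hσ2), one_smul]
  have hYε : ∀ i, ∀ ε : ℝ, 0 < ε → Y i + ε • W ∈ FC := by
    intro i ε hε
    refine ⟨haddC _ (hYC i) _ (hsmC _ hWC _ hε.le), ⟨1 + ε, by positivity, ?_⟩,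
      ⟨ε⁻¹, by positivity, ?_⟩⟩
    · have e : (1 + ε) • W - (Y i + ε • W) = W - Y i := by module
      rw [e]; exact hWY i
    · have e : ε⁻¹ • (Y i + ε • W) - W = ε⁻¹ • Y i := by
        rw [smul_add, smul_smul, inv_mul_cancel₀ hε.ne', one_smul]; abel
      rw [e]; exact hsmC _ (hYC i) _ (by positivity)
  have hφY : ∀ i, 0 < (σ • f1) (Y i) := by
    intro i
    have hcl : Y i ∈ closure FC := by
      have ht : Tendsto (fun ε : ℝ => Y i + ε • W) (nhdsWithin 0 (Set.Ioi 0))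
          (nhds (Y i + (0 : ℝ) • W)) := by
        have : Continuous (fun ε : ℝ => Y i + ε • W) := by fun_prop
        exact (this.tendsto 0).mono_left nhdsWithin_le_nhds
      rw [zero_smul, add_zero] at ht
      refine mem_closure_of_tendsto ht ?_
      filter_upwards [self_mem_nhdsWithin] with t htt
      exact hYε i t htt
    have hne : f1 (Y i) ≠ 0 := (f_rep_mk f1 (Y i) (hY0 i)).1
      (hf1 _ (mk_mem_closure (fun v hv => ⟨hFC0 v hv, hFCmk v hv⟩) hcl (hY0 i)))
    have hge : 0 ≤ σ * f1 (Y i) := by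
      have hcont : Continuous fun v => σ * f1 v :=
        continuous_const.mul f1.continuous_of_finiteDimensional
      exact closure_minimal (fun v hv => (hσpos v hv).le) (isClosed_le continuous_const hcont) hcl
    exact lt_of_le_of_ne hge (Ne.symm (mul_ne_zero (by rintro rfl; simp at hσ2) hne))
  refine ⟨w, ⟨hmkC W hWD hW0, fun h => hWU ⟨hfW, hW0, CΩ h⟩⟩, ?_⟩
  -- coarse dimension
  by_contra hcd
  have hmem := Nat.sInf_mem (s := {k : ℕ | ∃ R : ℝ, 0 < R ∧ ∃ B : Set (PSpace d), B ⊆ F ∧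
    Convex ℝ (cmap F '' B) ∧ pdimIn F B = k ∧
    (idealBdry C ∩ F) ⊆ {p ∈ F | ∃ q ∈ B, hilbertDist F p q < R}})
    ⟨pdimIn F F, 1, one_pos, F, Subset.refl _, hconv1, rfl, fun p hp =>
      ⟨hp.2, p, hp.2, by simp [hilbertDist, hilbertDistChart]⟩⟩
  obtain ⟨R, hR, B, hBF, -, hdim, hAB⟩ := hmem
  have hdim1 : Module.finrank ℝ (vectorSpan ℝ (cmap F '' B)) ≤ 1 := by
    rw [← direction_affineSpan]
    change pdimIn F B ≤ 1
    rw [hdim]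
    change cdim F (idealBdry C ∩ F) ≤ 1
    exact Nat.le_of_lt_succ (not_le.1 hcd)
  have hcol : Collinear ℝ (cmap F '' B) := collinear_iff_finrank_le_one.2 hdim1
  obtain ⟨ε, hε, hfin⟩ := coarse Cc isClosed_closure haddC hsmC Y hYC m hm0 hm hnot (σ • f1) hφY
    (Real.exp (2 * R)) (Real.exp_pos _)
  have hpick : ∀ i, ∃ q ∈ B, hilbertDist F (Projectivization.mk ℝ _ (hFC0 _ (hYε i ε hε))) q < R := by
    intro i
    refine (hAB ⟨⟨hmkC _ (cone_closure_add haddD (hYD i)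
      (cone_closure_smul hDne hsmD hWD hε.le)) _, ?_⟩, hFCmk _ (hYε i ε hε)⟩).2
    intro h
    have hin : Y i + ε • W ∈ U := ⟨hpos _ (hYε i ε hε).1 (hFC0 _ (hYε i ε hε)), _, CΩ h⟩
    have h2 := cone_open_add hU hadd hin (hWY i)
    have h3 := hsm _ h2 (1 + ε)⁻¹ (by positivity)
    apply hWU
    convert h3 using 1
    have e : Y i + ε • W + (W - Y i) = (1 + ε) • W := by module
    rw [e, smul_smul, inv_mul_cancel₀ (by positivity), one_smul]
  choose q hqB hq using hpick
  have hcmp : ∀ i, _ := fun i => hilbert_cmp (cmap F '' F) Cc FC f1 σ haddC hsmC hO (fun v hv => hv.1)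
    hFCo hbdd1 _ _ ⟨_, hFCmk _ (hYε i ε hε), rfl⟩ ⟨_, hBF (hqB i), rfl⟩ R hR (hq i)
  have hue : ∀ i, σ • cmap F (Projectivization.mk ℝ _ (hFC0 _ (hYε i ε hε))) =
      ((σ • f1) (Y i + ε • W))⁻¹ • (Y i + ε • W) := by
    intro i
    rw [hfe1, chartMap_mk, smul_smul]
    congr 1
    rw [LinearMap.smul_apply, smul_eq_mul, mul_inv]
    congr 1
    exact eq_inv_of_mul_eq_one_left hσ2
  refine hfin σ (fun i => cmap F (q i)) (hcol.subset ?_) ?_ ?_ ?_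
  · rintro z (rfl | rfl | rfl)
    · exact ⟨_, hqB 0, rfl⟩
    · exact ⟨_, hqB 1, rfl⟩
    · exact ⟨_, hqB 2, rfl⟩
  · intro i
    exact ((hO _).1 ⟨_, hBF (hqB i), rfl⟩).1.1
  · intro i
    have := (hcmp i).1
    rwa [hue] at this
  · intro i
    have := (hcmp i).2
    rwa [hue] at this

end Paper
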